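/- Let −1 < a1 < 0, δ > 0 and a2 ≤ −1. Then system (II) has a nonconstant periodic solution, and any two nonconstant periodic solutions of (II) have the same image (range) in ℝ × ℝ. (That is, system (II) has a unique limit cycle when a2 ≤ −1 and −1 < a1 < 0.) -/

import Mathlib

/-- A solution of system (II): x' = y, y' = −x(a1 + x²)(x² − 1) − δ(a2 + x²) y. -/
def IsSolII (a1 a2 δ : ℝ) (γ : ℝ → ℝ × ℝ) : Prop :=
  ∀ t : ℝ, HasDerivAt γ
    ((γ t).2,
      -((γ t).1 * (a1 + (γ t).1 ^ 2) * ((γ t).1 ^ 2 - 1))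
        - δ * (a2 + (γ t).1 ^ 2) * (γ t).2) t

/-- A nonconstant periodic solution of system (II). -/
def IsNonconstPeriodicSolII (a1 a2 δ : ℝ) (γ : ℝ → ℝ × ℝ) : Prop :=
  IsSolII a1 a2 δ γ ∧ (∃ T : ℝ, 0 < T ∧ ∀ t : ℝ, γ (t + T) = γ t) ∧
    ¬ (∀ t s : ℝ, γ t = γ s)

namespace SystemII

open Set Filter Topology Real

/-- The restoring force of (II). -/
noncomputable def force (a1 x : ℝ) : ℝ := x * (a1 + x ^ 2) * (x ^ 2 - 1)

/-- The damping coefficient of (II). -/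
noncomputable def damping (a2 δ x : ℝ) : ℝ := δ * (a2 + x ^ 2)

/-- The primitive of `force` vanishing at `0`. -/
noncomputable def potential (a1 x : ℝ) : ℝ := x ^ 6 / 6 + (a1 - 1) * x ^ 4 / 4 - a1 * x ^ 2 / 2

/-- The primitive of `damping` vanishing at `0`. -/
noncomputable def dampingPrim (a2 δ x : ℝ) : ℝ := δ * (a2 * x + x ^ 3 / 3)

lemma hasDerivAt_potential (a1 x : ℝ) : HasDerivAt (potential a1) (force a1 x) x := by
  unfold potential force
  have := (((hasDerivAt_pow 6 x).div_const 6).add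
    (((hasDerivAt_pow 4 x).const_mul (a1 - 1)).div_const 4)).sub
    (((hasDerivAt_pow 2 x).const_mul a1).div_const 2)
  refine this.congr_deriv ?_
  norm_num
  ring

lemma hasDerivAt_dampingPrim (a2 δ x : ℝ) :
    HasDerivAt (dampingPrim a2 δ) (damping a2 δ x) x := by
  unfold dampingPrim damping
  have := (((hasDerivAt_id x).const_mul a2).add ((hasDerivAt_pow 3 x).div_const 3)).const_mul δ
  refine this.congr_deriv ?_
  norm_num

lemma force_neg (a1 x : ℝ) : force a1 (-x) = -force a1 x := by
  unfold force; ring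

lemma damping_neg (a2 δ x : ℝ) : damping a2 δ (-x) = damping a2 δ x := by
  unfold damping; ring

lemma potential_neg (a1 x : ℝ) : potential a1 (-x) = potential a1 x := by
  unfold potential; ring

lemma force_pos_of_one_lt {a1 x : ℝ} (h : -1 < a1) (hx : 1 < x) : 0 < force a1 x := by
  unfold force
  have : 0 < x ^ 2 - 1 := by nlinarith
  have : 0 < a1 + x ^ 2 := by linarith
  positivity

/-! ### The fold: pairs of points around `1` at the same potential -/

/-- A parametrization of `[√(-a1), √((3 + a1) / 2)]` for `θ ∈ [-π/3, π/3]` such that the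
points of parameters `θ` and `-θ` have the same potential. -/
noncomputable def fold (a1 θ : ℝ) : ℝ := √((1 - a1) / 2 + (1 + a1) * cos (π / 3 - θ))

lemma fold_arg_ge {a1 θ : ℝ} (h : -1 < a1) (h1 : -(π / 3) ≤ θ) (h2 : θ ≤ π / 3) :
    -a1 ≤ (1 - a1) / 2 + (1 + a1) * cos (π / 3 - θ) := by
  have h3 : cos (π - π / 3) ≤ cos (π / 3 - θ) := by
    apply cos_le_cos_of_nonneg_of_le_pi <;> linarith [pi_pos]
  rw [cos_pi_sub, cos_pi_div_three] at h3
  nlinarith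

lemma fold_sq {a1 θ : ℝ} (h : -1 < a1) (h0 : a1 < 0) (h1 : -(π / 3) ≤ θ) (h2 : θ ≤ π / 3) :
    fold a1 θ ^ 2 = (1 - a1) / 2 + (1 + a1) * cos (π / 3 - θ) :=
  sq_sqrt (by linarith [fold_arg_ge h h1 h2])

lemma fold_pos {a1 θ : ℝ} (h : -1 < a1) (h0 : a1 < 0) (h1 : -(π / 3) ≤ θ) (h2 : θ ≤ π / 3) :
    0 < fold a1 θ :=
  sqrt_pos.2 (by linarith [fold_arg_ge h h1 h2])

lemma fold_zero (a1 : ℝ) : fold a1 0 = 1 := by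
  unfold fold
  rw [sub_zero, cos_pi_div_three, sqrt_eq_one]
  ring

lemma fold_neg_pi_div_three (a1 : ℝ) : fold a1 (-(π / 3)) = √(-a1) := by
  unfold fold
  have : π / 3 - -(π / 3) = π - π / 3 := by ring
  rw [this, cos_pi_sub, cos_pi_div_three]
  congr 1
  ring

lemma continuous_fold (a1 : ℝ) : Continuous (fold a1) := by
  unfold fold
  fun_prop

lemma fold_strictMonoOn {a1 : ℝ} (h : -1 < a1) (h0 : a1 < 0) :
    StrictMonoOn (fold a1) (Icc (-(π / 3)) (π / 3)) := by
  intro θ hθ η hη hlt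
  apply sqrt_lt_sqrt (by linarith [fold_arg_ge h hθ.1 hθ.2])
  have : cos (π / 3 - θ) < cos (π / 3 - η) := by
    apply cos_lt_cos_of_nonneg_of_le_pi <;> linarith [pi_pos, hθ.1, hη.2]
  nlinarith

/-- The rate of change of the potential along `fold`. -/
noncomputable def foldRate (a1 θ : ℝ) : ℝ := (1 + a1) ^ 3 / 8 * sin (3 * θ)

lemma foldRate_nonneg {a1 θ : ℝ} (h : -1 < a1) (h1 : 0 ≤ θ) (h2 : θ ≤ π / 3) :
    0 ≤ foldRate a1 θ := by
  have : 0 ≤ sin (3 * θ) := sin_nonneg_of_nonneg_of_le_pi (by linarith) (by linarith)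
  have : 0 < 1 + a1 := by linarith
  unfold foldRate
  positivity

lemma foldRate_neg (a1 θ : ℝ) : foldRate a1 (-θ) = -foldRate a1 θ := by
  unfold foldRate
  rw [mul_neg, sin_neg, mul_neg]

lemma exists_hasDerivAt_fold {a1 θ : ℝ} (h : -1 < a1) (h0 : a1 < 0) (h1 : -(π / 3) ≤ θ)
    (h2 : θ ≤ π / 3) :
    ∃ d, HasDerivAt (fold a1) d θ ∧ force a1 (fold a1 θ) * d = foldRate a1 θ := by
  have hp := fold_pos h h0 h1 h2
  have hsq := fold_sq h h0 h1 h2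
  have hd : HasDerivAt (fun θ => (1 - a1) / 2 + (1 + a1) * cos (π / 3 - θ))
      ((1 + a1) * sin (π / 3 - θ)) θ := by
    have := ((((hasDerivAt_id θ).const_sub (π / 3)).cos).const_mul (1 + a1)).const_add
      ((1 - a1) / 2)
    refine this.congr_deriv ?_
    simp
  refine ⟨_, hd.sqrt (by linarith [fold_arg_ge h h1 h2]), ?_⟩
  change force a1 (fold a1 θ) * ((1 + a1) * sin (π / 3 - θ) / (2 * fold a1 θ)) = _
  have h3 : sin (3 * θ) = sin (3 * (π / 3 - θ)) := by
    rw [show 3 * (π / 3 - θ) = π - 3 * θ by ring, sin_pi_sub]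
  have hcs := sin_sq_add_cos_sq (π / 3 - θ)
  rw [foldRate, h3, sin_three_mul, force]
  clear h3 hd
  generalize π / 3 - θ = φ at *
  field_simp
  rw [hsq]
  have h4 : sin φ ^ 2 = 1 - cos φ ^ 2 := by linarith
  rw [h4]
  ring

lemma dampingPrim_fold_lt {a1 a2 δ θ : ℝ} (h : -1 < a1) (h0 : a1 < 0) (hδ : 0 < δ)
    (ha2 : a2 ≤ -1) (h1 : 0 < θ) (h2 : θ ≤ π / 3) :
    dampingPrim a2 δ (fold a1 θ) < dampingPrim a2 δ (fold a1 (-θ)) := by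
  have s1 := fold_sq h h0 (by linarith) h2
  have s2 := fold_sq h h0 (θ := -θ) (by linarith) (by linarith)
  have hlt := fold_strictMonoOn h h0 (a := -θ) (b := θ) ⟨by linarith, by linarith⟩
    ⟨by linarith, h2⟩ (by linarith)
  have hc : cos θ < 1 := by
    have := cos_lt_cos_of_nonneg_of_le_pi le_rfl (by linarith [pi_pos]) h1
    rwa [cos_zero] at this
  have hsum : fold a1 θ ^ 2 + fold a1 (-θ) ^ 2 < 2 := by
    rw [s1, s2, sub_neg_eq_add, cos_sub, cos_add, cos_pi_div_three]
    nlinarith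
  have : dampingPrim a2 δ (fold a1 θ) - dampingPrim a2 δ (fold a1 (-θ)) =
    δ * ((fold a1 θ - fold a1 (-θ)) *
      (a2 + (fold a1 θ ^ 2 + fold a1 θ * fold a1 (-θ) + fold a1 (-θ) ^ 2) / 3)) := by
    unfold dampingPrim; ring
  have h5 : (fold a1 θ - fold a1 (-θ)) *
      (a2 + (fold a1 θ ^ 2 + fold a1 θ * fold a1 (-θ) + fold a1 (-θ) ^ 2) / 3) < 0 := by
    apply mul_neg_of_pos_of_neg (by linarith)
    nlinarith [sq_nonneg (fold a1 θ - fold a1 (-θ))]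
  nlinarith

/-- A function vanishing at `0` whose derivative is at least `a · P`, with `a` bounded,
is nonnegative. -/
lemma nonneg_of_deriv_ge {P P' a : ℝ → ℝ} {T M : ℝ} (hP : ContinuousOn P (Icc 0 T))
    (hd : ∀ t ∈ Ico 0 T, HasDerivAt P (P' t) t) (h0 : P 0 = 0)
    (ha : ∀ t ∈ Ico 0 T, a t ≤ M) (hM : 0 ≤ M)
    (hge : ∀ t ∈ Ico 0 T, a t * P t ≤ P' t) : ∀ t ∈ Icc 0 T, 0 ≤ P t := by
  intro t ht
  have key : ∀ ε > 0, -P t ≤ ε * exp ((M + 1) * t) := by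
    intro ε hε
    refine image_le_of_deriv_right_lt_deriv_boundary' (f := fun t => -P t)
      (f' := fun t => -P' t) (B := fun t => ε * exp ((M + 1) * t))
      (B' := fun t => ε * (exp ((M + 1) * t) * (M + 1))) hP.neg
      (fun x hx => (hd x hx).neg.hasDerivWithinAt) ?_ (by fun_prop) ?_ ?_ ht
    · simp [h0, hε.le]
    · intro x _
      have := ((((hasDerivAt_id x).const_mul (M + 1)).exp).const_mul ε).hasDerivWithinAt (s := Ici x)
      refine this.congr_deriv ?_
      simp
    · intro x hx hxe
      have h1 := hge x hx
      have h2 := ha x hx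
      have h3 : 0 < ε * exp ((M + 1) * x) := by positivity
      nlinarith
  by_contra hneg
  push Not at hneg
  have h3 : 0 < exp ((M + 1) * t) := exp_pos _
  have := key (-P t / (2 * exp ((M + 1) * t))) (by apply div_pos <;> linarith)
  rw [div_mul_eq_mul_div, le_div_iff₀ (by positivity)] at this
  nlinarith

lemma fold_compare {A B e k : ℝ → ℝ} {T : ℝ} (hT : 0 < T)
    (hA : ContinuousOn A (Icc 0 T)) (hB : ContinuousOn B (Icc 0 T))
    (he : Continuous e) (hk : Continuous k)
    (hA0 : ∀ t ∈ Ico 0 T, 0 < A t) (hB0 : ∀ t ∈ Ico 0 T, 0 < B t) (hk0 : ∀ t ∈ Icc 0 T, 0 ≤ k t)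
    (h0 : A 0 = B 0) (he0 : e 0 = 0) (hle : ∀ t ∈ Icc 0 T, e t ≤ 0)
    (hd : ∀ t ∈ Ico 0 T, HasDerivAt (fun t => A t - B t + e t) (k t * (1 / B t - 1 / A t)) t) :
    ∀ t ∈ Icc 0 T, 0 ≤ A t - B t + e t := by
  have hP : ContinuousOn (fun t => A t - B t + e t) (Icc 0 T) :=
    (hA.sub hB).add he.continuousOn
  have main : ∀ t ∈ Ico 0 T, 0 ≤ A t - B t + e t := by
    intro t ht
    have hsub : Icc 0 t ⊆ Ico 0 T := fun r hr => ⟨hr.1, hr.2.trans_lt ht.2⟩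
    have hac : ContinuousOn (fun r => k r / (A r * B r)) (Icc 0 t) := by
      apply hk.continuousOn.div
      · exact (hA.mono (hsub.trans Ico_subset_Icc_self)).mul
          (hB.mono (hsub.trans Ico_subset_Icc_self))
      · intro r hr
        exact (mul_pos (hA0 r (hsub hr)) (hB0 r (hsub hr))).ne'
    obtain ⟨M, hM⟩ := isCompact_Icc.bddAbove_image hac
    refine nonneg_of_deriv_ge (M := max M 0) (a := fun r => k r / (A r * B r))
      (hP.mono (hsub.trans Ico_subset_Icc_self))
      (fun r hr => hd r (hsub (Ico_subset_Icc_self hr))) (by simp [h0, he0])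
      (fun r hr => le_max_of_le_left (hM ⟨r, Ico_subset_Icc_self hr, rfl⟩)) (le_max_right _ _)
      ?_ t ⟨ht.1, le_rfl⟩
    intro r hr
    have hr' := hsub (Ico_subset_Icc_self hr)
    have hAr := hA0 r hr'
    have hBr := hB0 r hr'
    have hkr := hk0 r (Ico_subset_Icc_self hr')
    have her := hle r (Ico_subset_Icc_self hr')
    have : k r * (1 / B r - 1 / A r) = k r / (A r * B r) * (A r - B r) := by
      field_simp
    rw [this]
    exact mul_le_mul_of_nonneg_left (by linarith) (by positivity)
  intro t ht
  have hcl : Icc 0 T = closure (Ico 0 T) := (closure_Ico hT.ne).symm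
  rw [hcl] at ht hP
  have := hP.image_closure
  have hmem := this ⟨t, ht, rfl⟩
  have : closure ((fun t => A t - B t + e t) '' Ico 0 T) ⊆ Ici 0 :=
    closure_minimal (by rintro _ ⟨r, hr, rfl⟩; exact main r hr) isClosed_Ici
  exact this hmem

/-- The parameter range in which the limit cycle exists and is unique. -/
structure Admissible (a1 a2 δ : ℝ) : Prop where
  neg_one_lt : -1 < a1
  neg : a1 < 0
  pos : 0 < δ
  le_neg_one : a2 ≤ -1

variable {a1 a2 δ : ℝ}

lemma Admissible.one_le_sqrt (H : Admissible a1 a2 δ) : 1 ≤ √(-a2) :=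
  Real.one_le_sqrt.2 (by linarith [H.le_neg_one])

lemma Admissible.sqrt_pos (H : Admissible a1 a2 δ) : 0 < √(-a1) :=
  Real.sqrt_pos.2 (by linarith [H.neg])

lemma Admissible.sqrt_sq (H : Admissible a1 a2 δ) : √(-a1) ^ 2 = -a1 :=
  Real.sq_sqrt (by linarith [H.neg])

lemma Admissible.sqrt_lt_one (H : Admissible a1 a2 δ) : √(-a1) < 1 := by
  rw [sqrt_lt' one_pos]
  linarith [H.neg_one_lt]

lemma Admissible.sqrt_sq' (H : Admissible a1 a2 δ) : √(-a2) ^ 2 = -a2 :=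
  Real.sq_sqrt (by linarith [H.le_neg_one])

lemma Admissible.damping_neg_of_abs_lt (H : Admissible a1 a2 δ) {x : ℝ} (hx : |x| < √(-a2)) :
    damping a2 δ x < 0 := by
  have h1 := H.sqrt_sq'
  have h2 : x ^ 2 < -a2 := by
    rw [← h1, ← sq_abs]
    exact pow_lt_pow_left₀ hx (abs_nonneg x) two_ne_zero
  exact mul_neg_of_pos_of_neg H.pos (by linarith)

lemma Admissible.damping_nonneg_of_le_abs (H : Admissible a1 a2 δ) {x : ℝ} (hx : √(-a2) ≤ |x|) :
    0 ≤ damping a2 δ x := by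
  have h1 := H.sqrt_sq'
  have h2 : -a2 ≤ x ^ 2 := by
    rw [← h1, ← sq_abs x]
    exact pow_le_pow_left₀ (sqrt_nonneg _) hx 2
  exact mul_nonneg H.pos.le (by linarith)

lemma Admissible.damping_nonpos_of_abs_le (H : Admissible a1 a2 δ) {x : ℝ} (hx : |x| ≤ √(-a2)) :
    damping a2 δ x ≤ 0 := by
  have h1 := H.sqrt_sq'
  have h2 : x ^ 2 ≤ -a2 := by
    rw [← h1, ← sq_abs]
    exact pow_le_pow_left₀ (abs_nonneg _) hx 2
  exact mul_nonpos_of_nonneg_of_nonpos H.pos.le (by linarith)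

lemma Admissible.force_pos_of_lt_sqrt (H : Admissible a1 a2 δ) {x : ℝ} (h0 : 0 < x)
    (h : x < √(-a1)) : 0 < force a1 x := by
  have h1 := H.sqrt_sq
  have h2 := H.neg_one_lt
  have : x ^ 2 < -a1 := by nlinarith
  have h3 : x ^ 2 - 1 < 0 := by linarith
  have h4 : a1 + x ^ 2 < 0 := by linarith
  unfold force
  nlinarith [mul_pos (mul_pos h0 (neg_pos.2 h3)) (neg_pos.2 h4)]

lemma potential_sub_potential_sqrt (H : Admissible a1 a2 δ) (x : ℝ) :
    potential a1 x - potential a1 √(-a1) = (x ^ 2 + a1) ^ 2 * (2 * x ^ 2 - a1 - 3) / 12 := by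
  have h1 := H.sqrt_sq
  have h4 : √(-a1) ^ 4 = a1 ^ 2 := by
    rw [show √(-a1) ^ 4 = (√(-a1) ^ 2) ^ 2 by ring, h1]; ring
  have h6 : √(-a1) ^ 6 = -a1 ^ 3 := by
    rw [show √(-a1) ^ 6 = (√(-a1) ^ 2) ^ 3 by ring, h1]; ring
  unfold potential
  rw [h1, h4, h6]
  ring

lemma potential_le_potential_sqrt (H : Admissible a1 a2 δ) {x : ℝ} (hx : |x| ≤ 1) :
    potential a1 x ≤ potential a1 √(-a1) := by
  have h1 := potential_sub_potential_sqrt H x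
  have h2 : x ^ 2 ≤ 1 := (sq_le_one_iff_abs_le_one x).2 hx
  have h3 : 2 * x ^ 2 - a1 - 3 ≤ 0 := by linarith [H.neg_one_lt]
  nlinarith [mul_nonneg (sq_nonneg (x ^ 2 + a1)) (neg_nonneg.2 h3)]

/-- The point of the fold with the same potential as `√(-a1)`. -/
lemma one_lt_fold (H : Admissible a1 a2 δ) : 1 < fold a1 (π / 3) := by
  rw [← fold_zero a1]
  exact fold_strictMonoOn H.neg_one_lt H.neg ⟨by linarith [pi_pos], by linarith [pi_pos]⟩
    ⟨by linarith [pi_pos], le_rfl⟩ (by positivity)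

/-- `fold` hits every point of `[1, fold (π / 3)]`. -/
lemma exists_fold_eq_of_one_lt {x : ℝ} (h1 : 1 < x) (h2 : x ≤ fold a1 (π / 3)) :
    ∃ θ, 0 < θ ∧ θ ≤ π / 3 ∧ fold a1 θ = x := by
  have := intermediate_value_Icc (show (0 : ℝ) ≤ π / 3 by positivity)
    (continuous_fold a1).continuousOn
  rw [fold_zero] at this
  obtain ⟨θ, hθ, rfl⟩ := this ⟨h1.le, h2⟩
  refine ⟨θ, hθ.1.lt_of_ne ?_, hθ.2, rfl⟩
  rintro rfl
  rw [fold_zero] at h1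
  exact lt_irrefl _ h1

lemma exists_fold_eq_of_lt_one {x : ℝ} (h1 : √(-a1) ≤ x) (h2 : x < 1) :
    ∃ θ, 0 < θ ∧ θ ≤ π / 3 ∧ fold a1 (-θ) = x := by
  have := intermediate_value_Icc (show -(π / 3 : ℝ) ≤ 0 by linarith [pi_pos])
    (continuous_fold a1).continuousOn
  rw [fold_zero, fold_neg_pi_div_three] at this
  obtain ⟨θ, hθ, rfl⟩ := this ⟨h1, h2.le⟩
  refine ⟨-θ, ?_, by linarith [hθ.1], by rw [neg_neg]⟩
  have : θ ≠ 0 := by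
    rintro rfl
    rw [fold_zero] at h2
    exact lt_irrefl _ h2
  linarith [hθ.2.lt_of_ne this]

/-- A positive solution `w` of `w w' = f w - g` on `(p, b)`, continuous up to the ends: the curve
`y = -w x` is an orbit of (II) in the lower half plane. -/
structure IsArc (a1 a2 δ : ℝ) (w : ℝ → ℝ) (p b : ℝ) : Prop where
  lt : p < b
  cont : ContinuousOn w (Icc p b)
  pos : ∀ x ∈ Ioo p b, 0 < w x
  deriv : ∀ x ∈ Ioo p b, HasDerivAt w (damping a2 δ x - force a1 x / w x) x

namespace IsArc

variable {w : ℝ → ℝ} {p b : ℝ}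

lemma nonneg (A : IsArc a1 a2 δ w p b) : ∀ x ∈ Icc p b, 0 ≤ w x := by
  intro x hx
  rw [← closure_Ioo A.lt.ne] at hx
  have h := A.cont
  rw [← closure_Ioo A.lt.ne] at h
  have hmem := h.image_closure ⟨x, hx, rfl⟩
  have : closure (w '' Ioo p b) ⊆ Ici 0 :=
    closure_minimal (by rintro _ ⟨r, hr, rfl⟩; exact (A.pos r hr).le) isClosed_Ici
  exact this hmem

lemma hasDerivAt_comp_neg (A : IsArc a1 a2 δ w p b) {x : ℝ} (hx : -x ∈ Ioo p b) :
    HasDerivAt (fun x => w (-x)) (-damping a2 δ x - force a1 x / w (-x)) x := by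
  have := (A.deriv _ hx).scomp x (hasDerivAt_neg x)
  refine this.congr_deriv ?_
  rw [damping_neg, force_neg]
  simp only [smul_eq_mul]
  ring

lemma mono (A : IsArc a1 a2 δ w p b) {p' b' : ℝ} (h : p' < b') (hp : p ≤ p') (hb : b' ≤ b) :
    IsArc a1 a2 δ w p' b' where
  lt := h
  cont := A.cont.mono (Icc_subset_Icc hp hb)
  pos := fun x hx => A.pos x (Ioo_subset_Ioo hp hb hx)
  deriv := fun x hx => A.deriv x (Ioo_subset_Ioo hp hb hx)

/-- The energy along an arc. -/
lemma hasDerivAt_energy (A : IsArc a1 a2 δ w p b) {x : ℝ} (hx : x ∈ Ioo p b) :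
    HasDerivAt (fun x => w x ^ 2 / 2 + potential a1 x) (damping a2 δ x * w x) x := by
  have := (((A.deriv x hx).pow 2).div_const 2).add (hasDerivAt_potential a1 x)
  refine this.congr_deriv ?_
  have := (A.pos x hx).ne'
  field_simp
  norm_num
  ring

lemma continuousOn_energy (A : IsArc a1 a2 δ w p b) :
    ContinuousOn (fun x => w x ^ 2 / 2 + potential a1 x) (Icc p b) := by
  refine ((A.cont.pow 2).div_const 2).add ?_
  exact fun x _ => (hasDerivAt_potential a1 x).continuousAt.continuousWithinAt

/-- Fold comparison at positive abscissas. -/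
lemma fold_le (A : IsArc a1 a2 δ w p b) (H : Admissible a1 a2 δ) {θ : ℝ} (h0 : 0 < θ)
    (h1 : θ ≤ π / 3) (hp : p ≤ fold a1 (-θ)) (hb : fold a1 θ ≤ b) :
    w (fold a1 θ) + (dampingPrim a2 δ (fold a1 (-θ)) - dampingPrim a2 δ (fold a1 θ)) ≤
      w (fold a1 (-θ)) := by
  have hmono := fold_strictMonoOn H.neg_one_lt H.neg
  have hin : ∀ t ∈ Ico 0 θ, fold a1 t ∈ Ioo p b ∧ fold a1 (-t) ∈ Ioo p b := by
    intro t ht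
    have e1 : fold a1 (-θ) < fold a1 (-t) :=
      hmono ⟨by linarith, by linarith⟩ ⟨by linarith [ht.2], by linarith [ht.1]⟩ (by linarith [ht.2])
    have e2 : fold a1 (-t) ≤ fold a1 t :=
      hmono.monotoneOn ⟨by linarith [ht.2], by linarith [ht.1]⟩ ⟨by linarith [ht.1], by linarith [ht.2]⟩
        (by linarith [ht.1])
    have e3 : fold a1 t < fold a1 θ :=
      hmono ⟨by linarith [ht.1], by linarith [ht.2]⟩ ⟨by linarith, by linarith⟩ ht.2
    exact ⟨⟨by linarith, by linarith⟩, ⟨by linarith, by linarith⟩⟩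
  have hin' : ∀ t ∈ Icc 0 θ, fold a1 t ∈ Icc p b ∧ fold a1 (-t) ∈ Icc p b := by
    intro t ht
    have e1 : fold a1 (-θ) ≤ fold a1 (-t) :=
      hmono.monotoneOn ⟨by linarith, by linarith⟩ ⟨by linarith [ht.2], by linarith [ht.1]⟩
        (by linarith [ht.2])
    have e2 : fold a1 (-t) ≤ fold a1 t :=
      hmono.monotoneOn ⟨by linarith [ht.2], by linarith [ht.1]⟩ ⟨by linarith [ht.1], by linarith [ht.2]⟩
        (by linarith [ht.1])
    have e3 : fold a1 t ≤ fold a1 θ :=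
      hmono.monotoneOn ⟨by linarith [ht.1], by linarith [ht.2]⟩ ⟨by linarith, by linarith⟩ ht.2
    exact ⟨⟨by linarith, by linarith⟩, ⟨by linarith, by linarith⟩⟩
  have hF : Continuous (dampingPrim a2 δ) := by unfold dampingPrim; fun_prop
  have key := fold_compare (A := fun t => w (fold a1 (-t))) (B := fun t => w (fold a1 t))
    (e := fun t => dampingPrim a2 δ (fold a1 t) - dampingPrim a2 δ (fold a1 (-t)))
    (k := foldRate a1) h0
    (A.cont.comp ((continuous_fold a1).comp continuous_neg).continuousOn (fun t ht => (hin' t ht).2))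
    (A.cont.comp (continuous_fold a1).continuousOn (fun t ht => (hin' t ht).1))
    ((hF.comp (continuous_fold a1)).sub (hF.comp ((continuous_fold a1).comp continuous_neg)))
    (by unfold foldRate; fun_prop)
    (fun t ht => A.pos _ (hin t ht).2) (fun t ht => A.pos _ (hin t ht).1)
    (fun t ht => foldRate_nonneg H.neg_one_lt ht.1 (ht.2.trans h1))
    (by simp) (by simp) ?_ ?_ θ ⟨h0.le, le_rfl⟩
  · linarith
  · intro t ht
    rcases ht.1.eq_or_lt with rfl | h
    · simp
    · linarith [dampingPrim_fold_lt H.neg_one_lt H.neg H.pos H.le_neg_one h (ht.2.trans h1)]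
  · intro t ht
    obtain ⟨d, hd, hk⟩ := exists_hasDerivAt_fold (θ := t) H.neg_one_lt H.neg (by linarith [ht.1])
      (by linarith [ht.2])
    obtain ⟨d', hd', hk'⟩ := exists_hasDerivAt_fold (θ := -t) H.neg_one_lt H.neg
      (by linarith [ht.2]) (by linarith [ht.1])
    have hn := hd'.scomp t (hasDerivAt_neg t)
    have e1 := (A.deriv _ (hin t ht).1).scomp t hd
    have e2 := (A.deriv _ (hin t ht).2).scomp t hn
    have e3 := (hasDerivAt_dampingPrim a2 δ (fold a1 t)).scomp t hd
    have e4 := (hasDerivAt_dampingPrim a2 δ (fold a1 (-t))).scomp t hn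
    refine ((e2.sub e1).add (e3.sub e4)).congr_deriv ?_
    rw [foldRate_neg] at hk'
    simp only [smul_eq_mul]
    have p1 := (A.pos _ (hin t ht).1).ne'
    have p2 := (A.pos _ (hin t ht).2).ne'
    have : foldRate a1 t * (1 / w (fold a1 t) - 1 / w (fold a1 (-t))) =
      force a1 (fold a1 t) * d / w (fold a1 t) + force a1 (fold a1 (-t)) * d' / w (fold a1 (-t)) := by
      rw [hk, hk']; ring
    rw [this]
    ring

/-- Fold comparison at negative abscissas. -/
lemma fold_neg_le (A : IsArc a1 a2 δ w p b) (H : Admissible a1 a2 δ) {θ : ℝ} (h0 : 0 < θ)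
    (h1 : θ ≤ π / 3) (hp : p ≤ -fold a1 θ) (hb : -fold a1 (-θ) ≤ b) :
    w (-fold a1 (-θ)) + (dampingPrim a2 δ (fold a1 (-θ)) - dampingPrim a2 δ (fold a1 θ)) ≤
      w (-fold a1 θ) := by
  have hmono := fold_strictMonoOn H.neg_one_lt H.neg
  have hin : ∀ t ∈ Ico 0 θ, -fold a1 t ∈ Ioo p b ∧ -fold a1 (-t) ∈ Ioo p b := by
    intro t ht
    have e1 : fold a1 (-θ) < fold a1 (-t) :=
      hmono ⟨by linarith, by linarith⟩ ⟨by linarith [ht.2], by linarith [ht.1]⟩ (by linarith [ht.2])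
    have e2 : fold a1 (-t) ≤ fold a1 t :=
      hmono.monotoneOn ⟨by linarith [ht.2], by linarith [ht.1]⟩ ⟨by linarith [ht.1], by linarith [ht.2]⟩
        (by linarith [ht.1])
    have e3 : fold a1 t < fold a1 θ :=
      hmono ⟨by linarith [ht.1], by linarith [ht.2]⟩ ⟨by linarith, by linarith⟩ ht.2
    exact ⟨⟨by linarith, by linarith⟩, ⟨by linarith, by linarith⟩⟩
  have hin' : ∀ t ∈ Icc 0 θ, -fold a1 t ∈ Icc p b ∧ -fold a1 (-t) ∈ Icc p b := by
    intro t ht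
    have e1 : fold a1 (-θ) ≤ fold a1 (-t) :=
      hmono.monotoneOn ⟨by linarith, by linarith⟩ ⟨by linarith [ht.2], by linarith [ht.1]⟩
        (by linarith [ht.2])
    have e2 : fold a1 (-t) ≤ fold a1 t :=
      hmono.monotoneOn ⟨by linarith [ht.2], by linarith [ht.1]⟩ ⟨by linarith [ht.1], by linarith [ht.2]⟩
        (by linarith [ht.1])
    have e3 : fold a1 t ≤ fold a1 θ :=
      hmono.monotoneOn ⟨by linarith [ht.1], by linarith [ht.2]⟩ ⟨by linarith, by linarith⟩ ht.2
    exact ⟨⟨by linarith, by linarith⟩, ⟨by linarith, by linarith⟩⟩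
  have hF : Continuous (dampingPrim a2 δ) := by unfold dampingPrim; fun_prop
  have hfc := continuous_fold a1
  have key := fold_compare (A := fun t => w (-fold a1 t)) (B := fun t => w (-fold a1 (-t)))
    (e := fun t => dampingPrim a2 δ (fold a1 t) - dampingPrim a2 δ (fold a1 (-t)))
    (k := foldRate a1) h0
    (A.cont.comp hfc.neg.continuousOn (fun t ht => (hin' t ht).1))
    (A.cont.comp (hfc.comp continuous_neg).neg.continuousOn (fun t ht => (hin' t ht).2))
    ((hF.comp hfc).sub (hF.comp (hfc.comp continuous_neg)))
    (by unfold foldRate; fun_prop)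
    (fun t ht => A.pos _ (hin t ht).1) (fun t ht => A.pos _ (hin t ht).2)
    (fun t ht => foldRate_nonneg H.neg_one_lt ht.1 (ht.2.trans h1))
    (by simp) (by simp) ?_ ?_ θ ⟨h0.le, le_rfl⟩
  · linarith
  · intro t ht
    rcases ht.1.eq_or_lt with rfl | h
    · simp
    · linarith [dampingPrim_fold_lt H.neg_one_lt H.neg H.pos H.le_neg_one h (ht.2.trans h1)]
  · intro t ht
    obtain ⟨d, hd, hk⟩ := exists_hasDerivAt_fold (θ := t) H.neg_one_lt H.neg (by linarith [ht.1])
      (by linarith [ht.2])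
    obtain ⟨d', hd', hk'⟩ := exists_hasDerivAt_fold (θ := -t) H.neg_one_lt H.neg
      (by linarith [ht.2]) (by linarith [ht.1])
    have hn := hd'.scomp t (hasDerivAt_neg t)
    have e1 := (A.hasDerivAt_comp_neg (hin t ht).1).scomp t hd
    have e2 := (A.hasDerivAt_comp_neg (hin t ht).2).scomp t hn
    have e3 := (hasDerivAt_dampingPrim a2 δ (fold a1 t)).scomp t hd
    have e4 := (hasDerivAt_dampingPrim a2 δ (fold a1 (-t))).scomp t hn
    refine ((e1.sub e2).add (e3.sub e4)).congr_deriv ?_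
    rw [foldRate_neg] at hk'
    simp only [smul_eq_mul]
    have : foldRate a1 t * (1 / w (-fold a1 (-t)) - 1 / w (-fold a1 t)) =
      -(force a1 (fold a1 t) * d / w (-fold a1 t)) -
        force a1 (fold a1 (-t)) * d' / w (-fold a1 (-t)) := by
      rw [hk, hk']; ring
    rw [this]
    ring

lemma fold_lt (A : IsArc a1 a2 δ w p b) (H : Admissible a1 a2 δ) {θ : ℝ} (h0 : 0 < θ)
    (h1 : θ ≤ π / 3) (hp : p ≤ fold a1 (-θ)) (hb : fold a1 θ ≤ b) :
    w (fold a1 θ) < w (fold a1 (-θ)) := by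
  linarith [A.fold_le H h0 h1 hp hb,
    dampingPrim_fold_lt H.neg_one_lt H.neg H.pos H.le_neg_one h0 h1]

lemma fold_neg_lt (A : IsArc a1 a2 δ w p b) (H : Admissible a1 a2 δ) {θ : ℝ} (h0 : 0 < θ)
    (h1 : θ ≤ π / 3) (hp : p ≤ -fold a1 θ) (hb : -fold a1 (-θ) ≤ b) :
    w (-fold a1 (-θ)) < w (-fold a1 θ) := by
  linarith [A.fold_neg_le H h0 h1 hp hb,
    dampingPrim_fold_lt H.neg_one_lt H.neg H.pos H.le_neg_one h0 h1]

/-- The energy is strictly decreasing along an arc in the region of negative damping. -/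
lemma strictAntiOn_energy (A : IsArc a1 a2 δ w p b) (H : Admissible a1 a2 δ)
    (hp : -√(-a2) ≤ p) (hb : b ≤ √(-a2)) :
    StrictAntiOn (fun x => w x ^ 2 / 2 + potential a1 x) (Icc p b) := by
  refine strictAntiOn_of_deriv_neg (convex_Icc p b) A.continuousOn_energy ?_
  intro x hx
  rw [interior_Icc] at hx
  rw [(A.hasDerivAt_energy hx).deriv]
  exact mul_neg_of_neg_of_pos
    (H.damping_neg_of_abs_lt (abs_lt.2 ⟨by linarith [hx.1], by linarith [hx.2]⟩)) (A.pos x hx)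

/-- An arc coming from beyond the region of negative damping and landing to the left of `√(-a1)`
lands on the other side of that region. -/
lemma lt_neg_sqrt (A : IsArc a1 a2 δ w p b) (H : Admissible a1 a2 δ) (hw : w p = 0)
    (hb : √(-a2) ≤ b) (hp : p < √(-a1)) : p < -√(-a2) := by
  by_contra! hc
  have h1 := H.one_le_sqrt
  have h2 := H.sqrt_lt_one
  have B := A.mono (p' := p) (b' := √(-a2)) (by linarith) le_rfl hb
  have hE := B.strictAntiOn_energy H hc le_rfl
  have hs := hE (a := p) (b := √(-a1)) ⟨le_rfl, by linarith⟩ ⟨hp.le, by linarith⟩ hp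
  have hps := A.pos (√(-a1)) ⟨hp, by linarith⟩
  simp only [hw] at hs
  have hG : potential a1 √(-a1) < potential a1 p := by nlinarith
  have hp1 : 1 < |p| := by
    by_contra! hcon
    exact absurd (potential_le_potential_sqrt H hcon) (not_le.2 hG)
  have hp2 : p < -1 := by
    rcases lt_abs.1 hp1 with h | h <;> linarith
  have hs' := hE (a := p) (b := -p) ⟨le_rfl, by linarith⟩ ⟨by linarith, by linarith⟩ (by linarith)
  simp only [hw, potential_neg] at hs'
  nlinarith [sq_nonneg (w (-p))]

/-- On an arc symmetric about the origin, the left half is higher than the right half. -/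
lemma lt_comp_neg (A : IsArc a1 a2 δ w (-b) b) (H : Admissible a1 a2 δ) (h1 : w (-b) = 0)
    (h2 : w b = 0) (hb : √(-a2) < b) : ∀ x ∈ Ioo 0 b, w x < w (-x) := by
  have hc : 0 < √(-a2) := by linarith [H.one_le_sqrt]
  have hmem : ∀ x ∈ Icc 0 b, x ∈ Icc (-b) b ∧ -x ∈ Icc (-b) b := fun x hx =>
    ⟨⟨by linarith [hx.1, hx.2], hx.2⟩, ⟨by linarith [hx.2], by linarith [hx.1]⟩⟩
  have hmem' : ∀ x ∈ Ioo 0 b, x ∈ Ioo (-b) b ∧ -x ∈ Ioo (-b) b := fun x hx =>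
    ⟨⟨by linarith [hx.1, hx.2], hx.2⟩, ⟨by linarith [hx.2], by linarith [hx.1]⟩⟩
  have hcont : ContinuousOn (fun x => (w (-x) ^ 2 - w x ^ 2) / 2) (Icc 0 b) := by
    refine ContinuousOn.div_const (ContinuousOn.sub ?_ ?_) 2
    · exact (A.cont.comp continuousOn_neg (fun x hx => (hmem x hx).2)).pow 2
    · exact (A.cont.mono (fun x hx => (hmem x hx).1)).pow 2
  have hder : ∀ x ∈ Ioo 0 b, HasDerivAt (fun x => (w (-x) ^ 2 - w x ^ 2) / 2)
      (-damping a2 δ x * (w (-x) + w x)) x := by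
    intro x hx
    have e1 := (A.hasDerivAt_comp_neg (hmem' x hx).2).pow 2
    have e2 := (A.deriv x (hmem' x hx).1).pow 2
    refine ((e1.sub e2).div_const 2).congr_deriv ?_
    have p1 := (A.pos x (hmem' x hx).1).ne'
    have p2 := (A.pos _ (hmem' x hx).2).ne'
    field_simp
    norm_num
    field_simp
    ring
  have hpos : ∀ x ∈ Ioo 0 b, 0 < w (-x) + w x := fun x hx =>
    add_pos (A.pos _ (hmem' x hx).2) (A.pos x (hmem' x hx).1)
  have hup : StrictMonoOn (fun x => (w (-x) ^ 2 - w x ^ 2) / 2) (Icc 0 √(-a2)) := by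
    refine strictMonoOn_of_deriv_pos (convex_Icc _ _) (hcont.mono (Icc_subset_Icc le_rfl hb.le)) ?_
    intro x hx
    rw [interior_Icc] at hx
    have hx' : x ∈ Ioo 0 b := ⟨hx.1, hx.2.trans hb⟩
    rw [(hder x hx').deriv]
    exact mul_pos (neg_pos.2 (H.damping_neg_of_abs_lt (by rw [abs_of_pos hx.1]; exact hx.2)))
      (hpos x hx')
  have hdown : StrictAntiOn (fun x => (w (-x) ^ 2 - w x ^ 2) / 2) (Icc √(-a2) b) := by
    refine strictAntiOn_of_deriv_neg (convex_Icc _ _) (hcont.mono (Icc_subset_Icc hc.le le_rfl)) ?_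
    intro x hx
    rw [interior_Icc] at hx
    have hx' : x ∈ Ioo 0 b := ⟨hc.trans hx.1, hx.2⟩
    rw [(hder x hx').deriv]
    refine mul_neg_of_neg_of_pos (neg_neg_of_pos ?_) (hpos x hx')
    refine mul_pos H.pos ?_
    nlinarith [H.sqrt_sq', hx.1]
  intro x hx
  have hD : 0 < (w (-x) ^ 2 - w x ^ 2) / 2 := by
    rcases le_total x √(-a2) with h | h
    · have := hup (a := 0) (b := x) ⟨le_rfl, hc.le⟩ ⟨hx.1.le, h⟩ hx.1
      simpa using this
    · have := hdown (a := x) (b := b) ⟨h, hx.2.le⟩ ⟨hb.le, le_rfl⟩ hx.2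
      simpa [h1, h2] using this
  have p1 := A.pos x (hmem' x hx).1
  have p2 := A.pos _ (hmem' x hx).2
  by_contra! hcon
  nlinarith

lemma fold_lt_of_symm (A : IsArc a1 a2 δ w (-b) b) (H : Admissible a1 a2 δ) (h1 : w (-b) = 0)
    (hb : 1 < b) : fold a1 (π / 3) < b := by
  by_contra! hcon
  obtain ⟨θ, hθ0, hθ1, rfl⟩ := exists_fold_eq_of_one_lt hb hcon
  have hlt := fold_strictMonoOn H.neg_one_lt H.neg (a := -θ) (b := θ)
    ⟨by linarith, by linarith⟩ ⟨by linarith, hθ1⟩ (by linarith)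
  have h0 := fold_pos H.neg_one_lt H.neg (θ := -θ) (by linarith) (by linarith)
  have := A.fold_neg_lt H hθ0 hθ1 le_rfl (by linarith)
  have := A.nonneg (-fold a1 (-θ)) ⟨by linarith, by linarith⟩
  linarith

end IsArc

/-- The derivative of the logarithm of the difference of two arcs. -/
lemma hasDerivAt_log_sub {w₁ w₂ : ℝ → ℝ} {e g x : ℝ} (h1 : HasDerivAt w₁ (e - g / w₁ x) x)
    (h2 : HasDerivAt w₂ (e - g / w₂ x) x) (p1 : 0 < w₁ x) (hlt : w₁ x < w₂ x) :
    HasDerivAt (fun x => log (w₂ x - w₁ x)) (g / (w₁ x * w₂ x)) x := by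
  have hne : w₂ x - w₁ x ≠ 0 := (sub_pos.2 hlt).ne'
  refine ((h2.sub h1).log hne).congr_deriv ?_
  have p2 := (p1.trans hlt).ne'
  have p1 := p1.ne'
  change _ / (w₂ x - w₁ x) = _
  field_simp
  ring

/-- Two arcs symmetric about the origin cannot be nested. -/
theorem IsArc.not_nested {w₁ w₂ : ℝ → ℝ} {b₁ b₂ : ℝ} (H : Admissible a1 a2 δ)
    (A₁ : IsArc a1 a2 δ w₁ (-b₁) b₁) (A₂ : IsArc a1 a2 δ w₂ (-b₂) b₂)
    (hl₁ : w₁ (-b₁) = 0) (hr₁ : w₁ b₁ = 0) (hl₂ : w₂ (-b₂) = 0) (hr₂ : w₂ b₂ = 0)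
    (hb₁ : √(-a2) < b₁) (hb : b₁ < b₂) (hlt : ∀ x ∈ Icc (-b₁) b₁, w₁ x < w₂ x) : False := by
  have hc := H.one_le_sqrt
  have hs0 := H.sqrt_pos
  have hs1 := H.sqrt_lt_one
  have hfb := A₁.fold_lt_of_symm H hl₁ (by linarith)
  have h1f := one_lt_fold H
  have g₁ := A₁.lt_comp_neg H hl₁ hr₁ hb₁
  have g₂ := A₂.lt_comp_neg H hl₂ hr₂ (hb₁.trans hb)
  have m₁ : ∀ x ∈ Ioo 0 b₁, x ∈ Ioo (-b₁) b₁ ∧ -x ∈ Ioo (-b₁) b₁ := fun x hx =>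
    ⟨⟨by linarith [hx.1, hx.2], hx.2⟩, ⟨by linarith [hx.2], by linarith [hx.1]⟩⟩
  have m₂ : ∀ x ∈ Ioo 0 b₁, x ∈ Ioo (-b₂) b₂ ∧ -x ∈ Ioo (-b₂) b₂ := fun x hx =>
    ⟨⟨by linarith [hx.1, hx.2], by linarith [hx.2]⟩, ⟨by linarith [hx.2], by linarith [hx.1, hx.2]⟩⟩
  let L : ℝ → ℝ := fun x => log (w₂ (-x) - w₁ (-x)) - log (w₂ x - w₁ x)
  let Q : ℝ → ℝ := fun x => 1 / (w₁ (-x) * w₂ (-x)) - 1 / (w₁ x * w₂ x)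
  have hL : ContinuousOn L (Icc 0 b₁) := by
    have cw : ContinuousOn (fun x => log (w₂ x - w₁ x)) (Icc (-b₁) b₁) := by
      refine ContinuousOn.log ?_ (fun x hx => (sub_pos.2 (hlt x hx)).ne')
      exact (A₂.cont.mono (Icc_subset_Icc (by linarith) hb.le)).sub A₁.cont
    refine ContinuousOn.sub ?_ ?_
    · exact cw.comp continuousOn_neg
        (fun x hx => ⟨by linarith [hx.2], by linarith [hx.1, hx.2]⟩)
    · exact cw.mono (Icc_subset_Icc (by linarith) le_rfl)
  have hLd : ∀ x ∈ Ioo 0 b₁, HasDerivAt L (force a1 x * Q x) x := by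
    intro x hx
    have e1 := hasDerivAt_log_sub (A₁.deriv x (m₁ x hx).1) (A₂.deriv x (m₂ x hx).1)
      (A₁.pos x (m₁ x hx).1) (hlt x (Ioo_subset_Icc_self (m₁ x hx).1))
    have e2 := hasDerivAt_log_sub (w₁ := fun x => w₁ (-x)) (w₂ := fun x => w₂ (-x))
      (e := -damping a2 δ x) (g := force a1 x)
      (A₁.hasDerivAt_comp_neg (m₁ x hx).2) (A₂.hasDerivAt_comp_neg (m₂ x hx).2)
      (A₁.pos _ (m₁ x hx).2) (hlt _ (Ioo_subset_Icc_self (m₁ x hx).2))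
    refine (e2.sub e1).congr_deriv ?_
    simp only [Q]
    ring
  have hQ : ∀ x ∈ Ioo 0 b₁, Q x < 0 := by
    intro x hx
    have p1 := A₁.pos x (m₁ x hx).1
    have p2 := A₂.pos x (m₂ x hx).1
    exact sub_neg.2 (one_div_lt_one_div_of_lt (mul_pos p1 p2)
      (mul_lt_mul'' (g₁ x hx) (g₂ x ⟨hx.1, hx.2.trans hb⟩) p1.le p2.le))
  have hL0 : L 0 = 0 := by simp [L]
  have hLs : L √(-a1) < 0 := by
    rw [← hL0]
    refine strictAntiOn_of_deriv_neg (convex_Icc 0 √(-a1))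
      (hL.mono (Icc_subset_Icc le_rfl (by linarith))) ?_ ⟨le_rfl, hs0.le⟩ ⟨hs0.le, le_rfl⟩ hs0
    intro x hx
    rw [interior_Icc] at hx
    have hx' : x ∈ Ioo 0 b₁ := ⟨hx.1, by linarith [hx.2]⟩
    rw [(hLd x hx').deriv]
    exact mul_neg_of_pos_of_neg (H.force_pos_of_lt_sqrt hx.1 hx.2) (hQ x hx')
  have hLb : L b₁ ≤ L (fold a1 (π / 3)) := by
    refine antitoneOn_of_deriv_nonpos (convex_Icc (fold a1 (π / 3)) b₁)
      (hL.mono (Icc_subset_Icc (by linarith) le_rfl)) ?_ ?_ ⟨le_rfl, hfb.le⟩ ⟨hfb.le, le_rfl⟩ hfb.le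
    · intro x hx
      rw [interior_Icc] at hx
      exact (hLd x ⟨by linarith [hx.1], hx.2⟩).differentiableAt.differentiableWithinAt
    · intro x hx
      rw [interior_Icc] at hx
      have hx' : x ∈ Ioo 0 b₁ := ⟨by linarith [hx.1], hx.2⟩
      rw [(hLd x hx').deriv]
      exact mul_nonpos_of_nonneg_of_nonpos
        (force_pos_of_one_lt H.neg_one_lt (by linarith [hx.1])).le (hQ x hx').le
  have hfold : L (fold a1 (π / 3)) ≤ L √(-a1) := by
    have hmono := fold_strictMonoOn H.neg_one_lt H.neg
    have hpi := pi_pos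
    have hin : ∀ t ∈ Icc (-(π / 3)) (π / 3), fold a1 t ∈ Ioo 0 b₁ := fun t ht =>
      ⟨fold_pos H.neg_one_lt H.neg ht.1 ht.2,
        (hmono.monotoneOn ht ⟨by linarith, le_rfl⟩ ht.2).trans_lt hfb⟩
    have hneg : ∀ t ∈ Icc (0 : ℝ) (π / 3), t ∈ Icc (-(π / 3)) (π / 3) ∧
        -t ∈ Icc (-(π / 3)) (π / 3) := fun t ht =>
      ⟨⟨by linarith [ht.1], ht.2⟩, ⟨by linarith [ht.2], by linarith [ht.1]⟩⟩
    have hr : AntitoneOn (fun t => L (fold a1 t) - L (fold a1 (-t))) (Icc 0 (π / 3)) := by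
      have hd : ∀ t ∈ Ioo 0 (π / 3), HasDerivAt (fun t => L (fold a1 t) - L (fold a1 (-t)))
          (foldRate a1 t * (Q (fold a1 t) - Q (fold a1 (-t)))) t := by
        intro t ht
        have ht' := hneg t (Ioo_subset_Icc_self ht)
        obtain ⟨d, hd, hk⟩ := exists_hasDerivAt_fold (θ := t) H.neg_one_lt H.neg ht'.1.1 ht'.1.2
        obtain ⟨d', hd', hk'⟩ := exists_hasDerivAt_fold (θ := -t) H.neg_one_lt H.neg ht'.2.1 ht'.2.2
        have e1 := (hLd _ (hin _ ht'.1)).scomp t hd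
        have e2 := (hLd _ (hin _ ht'.2)).scomp t (hd'.scomp t (hasDerivAt_neg t))
        refine (e1.sub e2).congr_deriv ?_
        rw [foldRate_neg] at hk'
        simp only [smul_eq_mul]
        linear_combination Q (fold a1 t) * hk + Q (fold a1 (-t)) * hk'
      refine antitoneOn_of_deriv_nonpos (convex_Icc _ _) ?_ ?_ ?_
      · have hL' := hL.mono Ioo_subset_Icc_self
        refine ContinuousOn.sub ?_ ?_
        · exact hL'.comp (continuous_fold a1).continuousOn (fun t ht => hin t (hneg t ht).1)
        · exact hL'.comp ((continuous_fold a1).comp continuous_neg).continuousOn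
            (fun t ht => hin _ (hneg t ht).2)
      · intro t ht
        rw [interior_Icc] at ht
        exact (hd t ht).differentiableAt.differentiableWithinAt
      · intro t ht
        rw [interior_Icc] at ht
        have ht' := hneg t (Ioo_subset_Icc_self ht)
        rw [(hd t ht).deriv]
        refine mul_nonpos_of_nonneg_of_nonpos (foldRate_nonneg H.neg_one_lt ht.1.le ht.2.le) ?_
        have i1 := hin _ ht'.1
        have i2 := hin _ ht'.2
        have v₁ := A₁.fold_lt H ht.1 ht.2.le (by linarith [i2.1]) i1.2.le
        have v₂ := A₂.fold_lt H ht.1 ht.2.le (by linarith [i2.1]) (by linarith [i1.2])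
        have u₁ := A₁.fold_neg_lt H ht.1 ht.2.le (by linarith [i1.2]) (by linarith [i2.1])
        have u₂ := A₂.fold_neg_lt H ht.1 ht.2.le (by linarith [i1.2]) (by linarith [i2.1])
        have p1 := A₁.pos _ (m₁ _ i1).1
        have p2 := A₂.pos _ (m₂ _ i1).1
        have p3 := A₁.pos _ (m₁ _ i2).2
        have p4 := A₂.pos _ (m₂ _ i2).2
        have k1 := one_div_le_one_div_of_le (mul_pos p1 p2)
          (mul_le_mul v₁.le v₂.le p2.le (p1.trans v₁).le)
        have k2 := one_div_le_one_div_of_le (mul_pos p3 p4)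
          (mul_le_mul u₁.le u₂.le p4.le (p3.trans u₁).le)
        simp only [Q]
        linarith
    have := hr (a := 0) (b := π / 3) ⟨le_rfl, by positivity⟩ ⟨by positivity, le_rfl⟩ (by positivity)
    simp only [neg_zero, sub_self, fold_neg_pi_div_three] at this
    linarith
  have hLend : 0 < L b₁ := by
    have hb0 : 0 < b₁ := by linarith
    have := g₂ b₁ ⟨hb0, hb⟩
    have hp := hlt b₁ ⟨by linarith, le_rfl⟩
    simp only [L, hl₁, hr₁, sub_zero] at hp ⊢
    exact sub_pos.2 (log_lt_log hp this)
  linarith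

/-- The vector field of (II). -/
noncomputable def field (a1 a2 δ : ℝ) (z : ℝ × ℝ) : ℝ × ℝ :=
  (z.2, -force a1 z.1 - damping a2 δ z.1 * z.2)

lemma isSolII_iff {γ : ℝ → ℝ × ℝ} :
    IsSolII a1 a2 δ γ ↔ ∀ t, HasDerivAt γ (field a1 a2 δ (γ t)) t := Iff.rfl

lemma field_neg (z : ℝ × ℝ) : field a1 a2 δ (-z) = -field a1 a2 δ z := by
  simp only [field, Prod.fst_neg, Prod.snd_neg, force_neg, damping_neg, Prod.neg_mk]
  ring_nf

lemma contDiff_field (a1 a2 δ : ℝ) : ContDiff ℝ 1 (field a1 a2 δ) := by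
  unfold field force damping
  fun_prop

lemma hasDerivAt_fst {γ : ℝ → ℝ × ℝ} {v : ℝ × ℝ} {t : ℝ} (h : HasDerivAt γ v t) :
    HasDerivAt (fun t => (γ t).1) v.1 t :=
  (ContinuousLinearMap.fst ℝ ℝ ℝ).hasFDerivAt.comp_hasDerivAt t h

lemma hasDerivAt_snd {γ : ℝ → ℝ × ℝ} {v : ℝ × ℝ} {t : ℝ} (h : HasDerivAt γ v t) :
    HasDerivAt (fun t => (γ t).2) v.2 t :=
  (ContinuousLinearMap.snd ℝ ℝ ℝ).hasFDerivAt.comp_hasDerivAt t h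

lemma continuous_of_hasDerivAt {γ v : ℝ → ℝ × ℝ} (h : ∀ t, HasDerivAt γ (v t) t) :
    Continuous γ :=
  continuous_iff_continuousAt.2 fun t => (h t).continuousAt

/-! ### Elementary calculus -/

lemma eventually_neg_of_hasDerivAt {y : ℝ → ℝ} {d t : ℝ} (h : HasDerivAt y d t) (h0 : y t = 0)
    (hd : d < 0) : ∃ ε > 0, ∀ r ∈ Ioo 0 ε, y (t + r) < 0 ∧ 0 < y (t - r) := by
  have h1 := (hasDerivAt_iff_tendsto_slope.1 h).eventually (eventually_lt_nhds hd)
  rw [eventually_nhdsWithin_iff, Metric.eventually_nhds_iff] at h1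
  obtain ⟨ε, hε, hr⟩ := h1
  refine ⟨ε, hε, fun r hr' => ⟨?_, ?_⟩⟩
  · have := hr (y := t + r) (by rw [dist_eq]; simp [abs_of_pos hr'.1, hr'.2])
      (by simp [hr'.1.ne'])
    rw [slope_def_field, h0, div_neg_iff] at this
    rcases this with h | h <;> linarith [hr'.1]
  · have := hr (y := t - r) (by rw [dist_eq]; simp [abs_of_pos hr'.1, hr'.2])
      (by simp [hr'.1.ne'])
    rw [slope_def_field, h0, div_neg_iff] at this
    rcases this with h | h <;> linarith [hr'.1]

lemma exists_first_zero {y : ℝ → ℝ} {d T : ℝ} (hy : Continuous y) (h : HasDerivAt y d 0)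
    (h0 : y 0 = 0) (hd : d < 0) (hT : 0 < T) (hyT : 0 ≤ y T) :
    ∃ t₁, 0 < t₁ ∧ t₁ ≤ T ∧ y t₁ = 0 ∧ ∀ t ∈ Ioo 0 t₁, y t < 0 := by
  obtain ⟨ε, hε, hneg⟩ := eventually_neg_of_hasDerivAt h h0 hd
  have hneg' : ∀ r ∈ Ioo 0 ε, y r < 0 := fun r hr => by simpa using (hneg r hr).1
  have hTε : ε ≤ T := by
    by_contra! hcon
    linarith [hneg' T ⟨hT, hcon⟩]
  have hcomp : IsCompact (Icc (ε / 2) T ∩ y ⁻¹' Ici 0) :=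
    isCompact_Icc.inter_right (isClosed_Ici.preimage hy)
  obtain ⟨t₁, ⟨⟨h1, h2⟩, h3⟩, h4⟩ := hcomp.exists_isLeast ⟨T, ⟨by linarith, le_rfl⟩, hyT⟩
  have hall : ∀ t ∈ Ioo 0 t₁, y t < 0 := by
    intro t ht
    by_contra! hcon
    rcases lt_or_ge t (ε / 2) with h' | h'
    · linarith [hneg' t ⟨ht.1, by linarith⟩]
    · linarith [h4 ⟨⟨h', ht.2.le.trans h2⟩, hcon⟩, ht.2]
  have hpos : 0 < t₁ := by linarith
  refine ⟨t₁, hpos, h2, le_antisymm ?_ h3, hall⟩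
  have hcl : t₁ ∈ closure (Ioo 0 t₁) := by
    rw [closure_Ioo hpos.ne]
    exact ⟨hpos.le, le_rfl⟩
  exact closure_minimal (s := Ioo 0 t₁) (t := y ⁻¹' Iic 0) (fun t ht => (hall t ht).le)
    (isClosed_Iic.preimage hy) hcl

lemma nonneg_of_hasDerivAt_left {y : ℝ → ℝ} {d t₁ : ℝ} (h : HasDerivAt y d t₁) (h0 : y t₁ = 0)
    (ht₁ : 0 < t₁) (hneg : ∀ t ∈ Ioo 0 t₁, y t < 0) : 0 ≤ d := by
  by_contra! hd
  obtain ⟨ε, hε, hr⟩ := eventually_neg_of_hasDerivAt h h0 hd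
  have h1 : 0 < min ε t₁ := lt_min hε ht₁
  have h2 := (hr (min ε t₁ / 2) ⟨by linarith, by linarith [min_le_left ε t₁]⟩).2
  linarith [hneg (t₁ - min ε t₁ / 2) ⟨by linarith [min_le_right ε t₁], by linarith⟩]

/-! ### Orbits in the lower half plane are arcs -/

lemma strictAntiOn_fst {γ : ℝ → ℝ × ℝ} {t₁ : ℝ}
    (hγ : ∀ t ∈ Icc 0 t₁, HasDerivAt γ (field a1 a2 δ (γ t)) t)
    (hy : ∀ t ∈ Ioo 0 t₁, (γ t).2 < 0) : StrictAntiOn (fun t => (γ t).1) (Icc 0 t₁) := by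
  refine strictAntiOn_of_deriv_neg (convex_Icc _ _)
    (fun t ht => (hasDerivAt_fst (hγ t ht)).continuousAt.continuousWithinAt) ?_
  intro t ht
  rw [interior_Icc] at ht
  rw [(hasDerivAt_fst (hγ t (Ioo_subset_Icc_self ht))).deriv]
  exact hy t ht

lemma exists_isArc {γ : ℝ → ℝ × ℝ} {t₁ : ℝ} (h0 : 0 < t₁)
    (hγ : ∀ t ∈ Icc 0 t₁, HasDerivAt γ (field a1 a2 δ (γ t)) t)
    (hy : ∀ t ∈ Ioo 0 t₁, (γ t).2 < 0) :
    ∃ w, IsArc a1 a2 δ w (γ t₁).1 (γ 0).1 ∧ (∀ t ∈ Icc 0 t₁, w (γ t).1 = -(γ t).2) ∧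
      ∀ x ∈ Icc (γ t₁).1 (γ 0).1, ∃ t ∈ Icc 0 t₁, (γ t).1 = x := by
  have hanti := strictAntiOn_fst hγ hy
  have m0 : (0 : ℝ) ∈ Icc 0 t₁ := ⟨le_rfl, h0.le⟩
  have m1 : t₁ ∈ Icc 0 t₁ := ⟨h0.le, le_rfl⟩
  have hxc : ContinuousOn (fun t => (γ t).1) (Icc 0 t₁) :=
    fun t ht => (hasDerivAt_fst (hγ t ht)).continuousAt.continuousWithinAt
  have hyc : ContinuousOn (fun t => (γ t).2) (Icc 0 t₁) :=
    fun t ht => (hasDerivAt_snd (hγ t ht)).continuousAt.continuousWithinAt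
  have hsurj : ∀ x ∈ Icc (γ t₁).1 (γ 0).1, ∃ t ∈ Icc 0 t₁, (γ t).1 = x :=
    fun x hx => intermediate_value_Icc' h0.le hxc hx
  choose! τ hτ hxτ using hsurj
  have hτx : ∀ t ∈ Icc 0 t₁, τ (γ t).1 = t := by
    intro t ht
    have hm : (γ t).1 ∈ Icc (γ t₁).1 (γ 0).1 :=
      ⟨hanti.antitoneOn ht m1 ht.2, hanti.antitoneOn m0 ht ht.1⟩
    exact hanti.injOn (hτ _ hm) ht (hxτ _ hm)
  have hτc : ContinuousOn τ (Icc (γ t₁).1 (γ 0).1) := by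
    rw [continuousOn_iff_isClosed]
    intro C hC
    refine ⟨(fun t => (γ t).1) '' (Icc 0 t₁ ∩ C), ?_, ?_⟩
    · exact ((isCompact_Icc.inter_right hC).image_of_continuousOn
        (hxc.mono inter_subset_left)).isClosed
    · ext x
      constructor
      · rintro ⟨h1, h2⟩
        exact ⟨⟨τ x, ⟨hτ x h2, h1⟩, hxτ x h2⟩, h2⟩
      · rintro ⟨⟨t, ⟨h1, h2⟩, rfl⟩, h3⟩
        refine ⟨?_, h3⟩
        rw [mem_preimage, hτx t h1]
        exact h2
  have hint : ∀ x ∈ Ioo (γ t₁).1 (γ 0).1, τ x ∈ Ioo 0 t₁ := by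
    intro x hx
    have h1 := hτ x (Ioo_subset_Icc_self hx)
    have h2 := hxτ x (Ioo_subset_Icc_self hx)
    refine ⟨h1.1.lt_of_ne ?_, h1.2.lt_of_ne ?_⟩
    · intro h
      rw [← h] at h2
      exact hx.2.ne' h2
    · intro h
      rw [h] at h2
      exact hx.1.ne h2
  refine ⟨fun x => -(γ (τ x)).2, ⟨hanti m0 m1 h0, ?_, ?_, ?_⟩, ?_, fun x hx => ⟨τ x, hτ x hx, hxτ x hx⟩⟩
  · exact (hyc.comp hτc hτ).neg
  · intro x hx
    exact neg_pos.2 (hy _ (hint x hx))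
  · intro x hx
    have hy' := hy _ (hint x hx)
    have hx' := hxτ x (Ioo_subset_Icc_self hx)
    have hsol := hγ _ (hτ x (Ioo_subset_Icc_self hx))
    have hd : HasDerivAt τ ((γ (τ x)).2)⁻¹ x := by
      refine HasDerivAt.of_local_left_inverse (hτc.continuousAt (Icc_mem_nhds hx.1 hx.2))
        (hasDerivAt_fst hsol) hy'.ne ?_
      filter_upwards [Icc_mem_nhds hx.1 hx.2] with z hz using hxτ z hz
    have := ((hasDerivAt_snd hsol).scomp x hd).neg
    refine this.congr_deriv ?_
    simp only [field, smul_eq_mul]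
    rw [hx']
    have := hy'.ne
    field_simp
    ring
  · intro t ht
    simp only [hτx t ht]

/-! ### Uniqueness and symmetries -/

lemma sol_unique {γ₁ γ₂ : ℝ → ℝ × ℝ} (h₁ : IsSolII a1 a2 δ γ₁) (h₂ : IsSolII a1 a2 δ γ₂)
    (b₁ : Bornology.IsBounded (range γ₁)) (b₂ : Bornology.IsBounded (range γ₂)) {t : ℝ}
    (h : γ₁ t = γ₂ t) : γ₁ = γ₂ := by
  obtain ⟨R, hR⟩ := (b₁.union b₂).subset_closedBall 0
  obtain ⟨K, hK⟩ := (contDiff_field a1 a2 δ).contDiffOn.exists_lipschitzOnWith one_ne_zero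
    (convex_closedBall (0 : ℝ × ℝ) R) (isCompact_closedBall _ _)
  exact ODE_solution_unique_univ (v := fun _ => field a1 a2 δ)
    (s := fun _ => Metric.closedBall 0 R) (fun _ => hK)
    (fun t => ⟨h₁ t, hR (Or.inl ⟨t, rfl⟩)⟩) (fun t => ⟨h₂ t, hR (Or.inr ⟨t, rfl⟩)⟩) h

lemma _root_.IsSolII.neg {γ : ℝ → ℝ × ℝ} (h : IsSolII a1 a2 δ γ) :
    IsSolII a1 a2 δ (fun t => -γ t) := by
  rw [isSolII_iff] at h ⊢
  intro t
  rw [field_neg]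
  exact (h t).neg

lemma _root_.IsSolII.shift {γ : ℝ → ℝ × ℝ} (h : IsSolII a1 a2 δ γ) (r : ℝ) :
    IsSolII a1 a2 δ (fun t => γ (t + r)) :=
  fun t => (h (t + r)).comp_add_const t r

lemma _root_.IsNonconstPeriodicSolII.neg {γ : ℝ → ℝ × ℝ} (h : IsNonconstPeriodicSolII a1 a2 δ γ) :
    IsNonconstPeriodicSolII a1 a2 δ (fun t => -γ t) := by
  obtain ⟨h1, ⟨T, hT, hp⟩, h3⟩ := h
  refine ⟨h1.neg, ⟨T, hT, fun t => congrArg Neg.neg (hp t)⟩, fun hc => h3 fun t s => ?_⟩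
  simpa using hc t s

lemma _root_.IsNonconstPeriodicSolII.shift {γ : ℝ → ℝ × ℝ}
    (h : IsNonconstPeriodicSolII a1 a2 δ γ) (r : ℝ) :
    IsNonconstPeriodicSolII a1 a2 δ (fun t => γ (t + r)) := by
  obtain ⟨h1, ⟨T, hT, hp⟩, h3⟩ := h
  refine ⟨h1.shift r, ⟨T, hT, fun t => ?_⟩, fun hc => h3 fun t s => ?_⟩
  · change γ (t + T + r) = γ (t + r)
    rw [add_right_comm, hp]
  · simpa using hc (t - r) (s - r)

lemma _root_.IsNonconstPeriodicSolII.continuous {γ : ℝ → ℝ × ℝ}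
    (h : IsNonconstPeriodicSolII a1 a2 δ γ) : Continuous γ :=
  continuous_of_hasDerivAt h.1

lemma _root_.IsNonconstPeriodicSolII.isCompact_range {γ : ℝ → ℝ × ℝ}
    (h : IsNonconstPeriodicSolII a1 a2 δ γ) : IsCompact (range γ) := by
  obtain ⟨T, hT, hp⟩ := h.2.1
  exact Function.Periodic.compact_of_continuous hp hT.ne' h.continuous

lemma _root_.IsNonconstPeriodicSolII.eq_of_eq {γ₁ γ₂ : ℝ → ℝ × ℝ}
    (h₁ : IsNonconstPeriodicSolII a1 a2 δ γ₁) (h₂ : IsNonconstPeriodicSolII a1 a2 δ γ₂) {t r : ℝ}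
    (h : γ₁ t = γ₂ r) (u : ℝ) : γ₁ (t + u) = γ₂ (r + u) := by
  have := sol_unique (h₁.1.shift t) (h₂.1.shift r) (h₁.shift t).isCompact_range.isBounded
    (h₂.shift r).isCompact_range.isBounded (t := 0) (by simpa using h)
  simpa [add_comm] using congrFun this u

lemma _root_.IsNonconstPeriodicSolII.force_ne_zero {γ : ℝ → ℝ × ℝ}
    (h : IsNonconstPeriodicSolII a1 a2 δ γ) {t : ℝ} (hy : (γ t).2 = 0) :
    force a1 (γ t).1 ≠ 0 := by
  intro hf
  have hc : IsSolII a1 a2 δ (fun _ => γ t) := by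
    rw [isSolII_iff]
    intro r
    refine (hasDerivAt_const r (γ t)).congr_deriv ?_
    simp [field, hf, hy, Prod.zero_eq_mk]
  have := sol_unique h.1 hc h.isCompact_range.isBounded
    (by rw [range_const]; exact Bornology.isBounded_singleton) (t := t) rfl
  exact h.2.2 fun r s => by rw [this]

/-- From a point of the axis with positive force, a periodic solution makes a half-turn in the lower
half plane. -/
lemma _root_.IsNonconstPeriodicSolII.half_turn {γ : ℝ → ℝ × ℝ}
    (h : IsNonconstPeriodicSolII a1 a2 δ γ) (hy : (γ 0).2 = 0) (hf : 0 < force a1 (γ 0).1) :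
    ∃ t₁, 0 < t₁ ∧ (γ t₁).2 = 0 ∧ force a1 (γ t₁).1 < 0 ∧ ∀ t ∈ Ioo 0 t₁, (γ t).2 < 0 := by
  obtain ⟨T, hT, hp⟩ := h.2.1
  have hT0 : γ T = γ 0 := by simpa using hp 0
  have hd : ∀ t, (γ t).2 = 0 → HasDerivAt (fun t => (γ t).2) (-force a1 (γ t).1) t := by
    intro t ht
    refine (hasDerivAt_snd (isSolII_iff.1 h.1 t)).congr_deriv ?_
    simp [field, ht]
  obtain ⟨t₁, h1, -, h3, h4⟩ := exists_first_zero (continuous_snd.comp h.continuous) (hd 0 hy) hy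
    (neg_neg_of_pos hf) hT (by simp [hT0, hy])
  refine ⟨t₁, h1, h3, lt_of_le_of_ne ?_ (h.force_ne_zero h3), h4⟩
  have := nonneg_of_hasDerivAt_left (hd t₁ h3) h3 h1 h4
  linarith

lemma lt_and_lt_one_of_force_neg (H : Admissible a1 a2 δ) {x : ℝ} (hs : √(-a1) ≤ x)
    (hf : force a1 x < 0) : √(-a1) < x ∧ x < 1 := by
  have h1 := H.sqrt_sq
  have h0 := H.sqrt_pos
  constructor
  · refine hs.lt_of_ne ?_
    rintro rfl
    unfold force at hf
    rw [h1] at hf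
    simp at hf
  · by_contra! hcon
    have h2 : 0 ≤ x ^ 2 - 1 := by nlinarith
    have h3 : 0 ≤ a1 + x ^ 2 := by nlinarith [H.neg_one_lt]
    have : 0 ≤ x * (a1 + x ^ 2) * (x ^ 2 - 1) :=
      mul_nonneg (mul_nonneg (by linarith) h3) h2
    unfold force at hf
    linarith

lemma one_lt_of_force_pos (H : Admissible a1 a2 δ) {x : ℝ} (hs : √(-a1) < x)
    (hf : 0 < force a1 x) : 1 < x := by
  by_contra! hcon
  have h1 := H.sqrt_sq
  have h0 := H.sqrt_pos
  have h2 : x ^ 2 - 1 ≤ 0 := by nlinarith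
  have h3 : 0 ≤ a1 + x ^ 2 := by nlinarith
  have : x * (a1 + x ^ 2) * (x ^ 2 - 1) ≤ 0 :=
    mul_nonpos_of_nonneg_of_nonpos (mul_nonneg (by linarith) h3) h2
  unfold force at hf
  linarith

lemma snd_eq_zero_of_extremal {γ : ℝ → ℝ × ℝ} (h : IsSolII a1 a2 δ γ) {b t : ℝ}
    (hb : ∀ r, |(γ r).1| ≤ b) (ht : |(γ t).1| = b) : (γ t).2 = 0 := by
  have hd := hasDerivAt_fst (isSolII_iff.1 h t)
  rcases le_total 0 (γ t).1 with h0 | h0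
  · rw [abs_of_nonneg h0] at ht
    refine IsLocalMax.hasDerivAt_eq_zero (Eventually.of_forall fun r => ?_) hd
    rw [ht]
    exact (le_abs_self _).trans (hb r)
  · rw [abs_of_nonpos h0] at ht
    refine IsLocalMin.hasDerivAt_eq_zero (Eventually.of_forall fun r => ?_) hd
    have := (neg_le_abs (γ r).1).trans (hb r)
    show (γ t).1 ≤ (γ r).1
    linarith

/-- A limit cycle leaves the region of negative damping. -/
lemma sqrt_lt_of_periodic (H : Admissible a1 a2 δ) {γ : ℝ → ℝ × ℝ}
    (h : IsNonconstPeriodicSolII a1 a2 δ γ) {b : ℝ} (hb : ∀ t, |(γ t).1| ≤ b) :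
    √(-a2) < b := by
  by_contra! hcon
  obtain ⟨T, hT, hp⟩ := h.2.1
  have hsol := isSolII_iff.1 h.1
  let E : ℝ → ℝ := fun t => (γ t).2 ^ 2 / 2 + potential a1 (γ t).1
  have hE : ∀ t, HasDerivAt E (-(damping a2 δ (γ t).1 * (γ t).2 ^ 2)) t := by
    intro t
    have e1 := hasDerivAt_fst (hsol t)
    have e2 := hasDerivAt_snd (hsol t)
    have e3 := (hasDerivAt_potential a1 (γ t).1).scomp t e1
    refine (((e2.pow 2).div_const 2).add e3).congr_deriv ?_
    simp only [field, smul_eq_mul]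
    norm_num
    ring
  have hnn : ∀ t, 0 ≤ -(damping a2 δ (γ t).1 * (γ t).2 ^ 2) := fun t =>
    neg_nonneg.2 (mul_nonpos_of_nonpos_of_nonneg
      (H.damping_nonpos_of_abs_le ((hb t).trans hcon)) (sq_nonneg _))
  have hmono : Monotone E := monotone_of_deriv_nonneg (fun t => (hE t).differentiableAt)
    (fun t => by rw [(hE t).deriv]; exact hnn t)
  have hper : ∀ n : ℕ, ∀ t, E (t + n * T) = E t := by
    intro n t
    have : γ (t + n * T) = γ t := by
      have := (Function.Periodic.nat_mul (f := γ) hp n) t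
      simpa using this
    simp only [E, this]
  have hconst : ∀ t r, t ≤ r → E r = E t := by
    intro t r htr
    refine le_antisymm ?_ (hmono htr)
    obtain ⟨n, hn⟩ := exists_nat_ge ((r - t) / T)
    rw [div_le_iff₀ hT] at hn
    rw [← hper n t]
    exact hmono (by linarith)
  have hzero : ∀ t, damping a2 δ (γ t).1 * (γ t).2 ^ 2 = 0 := by
    intro t
    have hcs : E = fun _ => E 0 := by
      funext r
      rcases le_total 0 r with h0 | h0
      · exact hconst 0 r h0
      · exact (hconst r 0 h0).symm
    have h2 := hE t
    rw [hcs] at h2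
    have := h2.unique (hasDerivAt_const t (E 0))
    linarith
  have hy : ∀ t, (γ t).2 = 0 := by
    intro t
    rcases (hb t).lt_or_eq with h1 | h1
    · have h2 := H.damping_neg_of_abs_lt (h1.trans_le hcon)
      rcases mul_eq_zero.1 (hzero t) with h3 | h3
      · exact absurd h3 h2.ne
      · exact pow_eq_zero_iff two_ne_zero |>.1 h3
    · exact snd_eq_zero_of_extremal h.1 hb h1
  have hx : ∀ t r, (γ t).1 = (γ r).1 := by
    refine is_const_of_deriv_eq_zero (f := fun t => (γ t).1)
      (fun t => (hasDerivAt_fst (hsol t)).differentiableAt) fun t => ?_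
    rw [(hasDerivAt_fst (hsol t)).deriv]
    exact hy t
  exact h.2.2 fun t r => Prod.ext (hx t r) (by rw [hy, hy])

/-- Normal form of a limit cycle: up to a shift and a reflection, it starts at its rightmost point,
is symmetric about the origin and its lower half is an arc. -/
lemma exists_symm_arc (H : Admissible a1 a2 δ) {γ : ℝ → ℝ × ℝ}
    (h : IsNonconstPeriodicSolII a1 a2 δ γ) {b : ℝ} (hb : ∀ t, |(γ t).1| ≤ b)
    (h0 : (γ 0).1 = b) :
    √(-a2) < b ∧ (γ 0).2 = 0 ∧ (∃ t₁, ∀ t, γ (t + t₁) = -γ t) ∧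
      ∃ w, IsArc a1 a2 δ w (-b) b ∧ w (-b) = 0 ∧ w b = 0 ∧
        ∀ x ∈ Icc (-b) b, ∃ t, γ t = (x, -w x) := by
  have hcb := sqrt_lt_of_periodic H h hb
  have hc1 := H.one_le_sqrt
  have hs1 := H.sqrt_lt_one
  have hy0 : (γ 0).2 = 0 :=
    snd_eq_zero_of_extremal h.1 hb (by rw [h0, abs_of_pos (by linarith)])
  have hfb : 0 < force a1 b := force_pos_of_one_lt H.neg_one_lt (by linarith)
  obtain ⟨t₁, ht₁, hyt₁, hft₁, hneg₁⟩ := h.half_turn hy0 (by rwa [h0])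
  obtain ⟨w, A, hw, hwsurj⟩ := exists_isArc ht₁ (fun t _ => isSolII_iff.1 h.1 t) hneg₁
  have hw0 : w b = 0 := by
    have := hw 0 ⟨le_rfl, ht₁.le⟩
    rwa [h0, hy0, neg_zero] at this
  have hw1 : w (γ t₁).1 = 0 := by
    rw [hw t₁ ⟨ht₁.le, le_rfl⟩, hyt₁, neg_zero]
  rw [h0] at A hwsurj
  set p := (γ t₁).1 with hp
  have hps : p < √(-a1) := by
    by_contra! hcon
    obtain ⟨h1, h2⟩ := lt_and_lt_one_of_force_neg H hcon hft₁
    obtain ⟨θ, hθ0, hθ1, hθp⟩ := exists_fold_eq_of_lt_one hcon h2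
    have hmono := fold_strictMonoOn H.neg_one_lt H.neg
    have hlt := hmono (a := -θ) (b := θ) ⟨by linarith, by linarith⟩ ⟨by linarith, hθ1⟩ (by linarith)
    have hbθ : b < fold a1 θ := by
      by_contra! hcon'
      have := A.fold_lt H hθ0 hθ1 hθp.ge hcon'
      rw [hθp, hw1] at this
      have := A.nonneg (fold a1 θ) ⟨by linarith, hcon'⟩
      linarith
    have h' : IsNonconstPeriodicSolII a1 a2 δ (fun t => -γ (t + t₁)) := (h.shift t₁).neg
    obtain ⟨t₃, ht₃, hyt₃, hft₃, hneg₃⟩ := h'.half_turn (by simp [hyt₁])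
      (by simp only [zero_add, Prod.fst_neg, force_neg]; linarith)
    obtain ⟨U, B, hU, -⟩ := exists_isArc ht₃ (fun t _ => isSolII_iff.1 h'.1 t) hneg₃
    have hU1 := hU t₃ ⟨ht₃.le, le_rfl⟩
    simp only [zero_add, Prod.fst_neg, Prod.snd_neg, ← hp, neg_neg] at B hU1 hft₃ hyt₃
    rw [neg_eq_zero.1 hyt₃] at hU1
    have hBlt := B.lt
    rw [force_neg] at hft₃
    set q := (γ (t₃ + t₁)).1 with hq
    have hqb : q ≤ b := (le_abs_self _).trans (hb _)
    have hq1 := one_lt_of_force_pos H (x := q) (by linarith) (by linarith)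
    have hθmax : fold a1 θ ≤ fold a1 (π / 3) :=
      hmono.monotoneOn ⟨by linarith, hθ1⟩ ⟨by linarith [pi_pos], le_rfl⟩ hθ1
    obtain ⟨η, hη0, hη1, hηq⟩ := exists_fold_eq_of_one_lt hq1 (by linarith)
    have hηθ : η < θ := by
      rw [← hmono.lt_iff_lt (a := η) (b := θ) ⟨by linarith, hη1⟩ ⟨by linarith, hθ1⟩]
      linarith
    have hηp := hmono (a := -θ) (b := -η) ⟨by linarith, by linarith⟩ ⟨by linarith, by linarith⟩
      (by linarith)
    have hηη := hmono (a := -η) (b := η) ⟨by linarith, by linarith⟩ ⟨by linarith, by linarith⟩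
      (by linarith)
    have := B.fold_neg_lt H hη0 hη1 (by linarith) (by linarith)
    rw [hηq, hU1] at this
    have := B.nonneg (-fold a1 (-η)) ⟨by linarith, by linarith⟩
    linarith
  have hpc := A.lt_neg_sqrt H hw1 hcb.le hps
  have hpb : -b ≤ p := (abs_le.1 (hb t₁)).1
  have hpb' : p = -b := by
    by_contra hne
    have hlt : -b < p := hpb.lt_of_ne (Ne.symm hne)
    obtain ⟨T, hT, hper⟩ := h.2.1
    have hcont : Continuous (fun t => -(γ (-t)).2) :=
      (continuous_snd.comp (h.continuous.comp continuous_neg)).neg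
    have hd : ∀ t, (γ (-t)).2 = 0 →
        HasDerivAt (fun t => -(γ (-t)).2) (-force a1 (γ (-t)).1) t := by
      intro t ht
      refine ((hasDerivAt_snd (isSolII_iff.1 h.1 (-t))).scomp t (hasDerivAt_neg t)).neg.congr_deriv ?_
      simp [field, ht]
    obtain ⟨t₂, ht₂, -, hyt₂, hneg₂⟩ := exists_first_zero hcont (hd 0 (by simpa using hy0))
      (by simpa using hy0) (by simpa [h0] using hfb) hT (by
        have := hper (-T)
        rw [neg_add_cancel] at this
        simp only [← this, hy0, neg_zero, le_refl])
    have hyt₂' : (γ (-t₂)).2 = 0 := neg_eq_zero.1 hyt₂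
    have hd₂ := nonneg_of_hasDerivAt_left (hd t₂ hyt₂') hyt₂ ht₂ hneg₂
    set p' := (γ (-t₂)).1 with hp'
    have hp'1 : p' ≤ 1 := by
      by_contra! hcon
      linarith [force_pos_of_one_lt H.neg_one_lt hcon]
    have hτ : IsNonconstPeriodicSolII a1 a2 δ (fun t => -γ (t + -t₂)) := (h.shift (-t₂)).neg
    have hτneg : ∀ t ∈ Ioo 0 t₂, (-γ (t + -t₂)).2 < 0 := by
      intro t ht
      have := hneg₂ (t₂ - t) ⟨by linarith [ht.2], by linarith [ht.1]⟩
      rw [neg_sub] at this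
      rwa [Prod.snd_neg, ← sub_eq_add_neg]
    obtain ⟨v, B, hv, hvsurj⟩ := exists_isArc ht₂ (fun t _ => isSolII_iff.1 hτ.1 t) hτneg
    have hv0 := hv 0 ⟨le_rfl, ht₂.le⟩
    have hv1 := hv t₂ ⟨ht₂.le, le_rfl⟩
    simp only [add_neg_cancel, zero_add, Prod.fst_neg, Prod.snd_neg, h0, hy0, hyt₂', ← hp',
      neg_zero] at B hv0 hv1 hvsurj
    have hp'b : -p' ≤ b := by linarith [(abs_le.1 (hb (-t₂))).1]
    have hpp' : p < -p' := by linarith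
    obtain ⟨x, hx, hvw⟩ : ∃ x ∈ Icc p (-p'), v x - w x = 0 := by
      refine intermediate_value_Icc' hpp'.le ((B.cont.mono (Icc_subset_Icc hlt.le le_rfl)).sub
        (A.cont.mono (Icc_subset_Icc le_rfl hp'b))) ⟨?_, ?_⟩
      · have := A.nonneg (-p') ⟨hpp'.le, hp'b⟩
        change v (-p') - w (-p') ≤ 0
        linarith
      · have := B.pos p ⟨hlt, hpp'⟩
        change 0 ≤ v p - w p
        linarith
    have hxp : p ≠ x := by
      rintro rfl
      have := B.pos p ⟨hlt, hpp'⟩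
      linarith
    obtain ⟨ta, hta, hxa⟩ := hvsurj x ⟨by linarith [hx.1], hx.2⟩
    obtain ⟨tb, htb, hxb⟩ := hwsurj x ⟨hx.1, hx.2.trans hp'b⟩
    have hya := hv ta hta
    have hyb := hw tb htb
    simp only [Prod.fst_neg, Prod.snd_neg, hxa] at hya
    rw [hxb] at hyb
    have hmeet : ∀ u, -γ (ta + u + -t₂) = γ (tb + u) := by
      refine hτ.eq_of_eq h (Prod.ext ?_ ?_)
      · rw [hxb]; exact hxa
      · simp only [Prod.snd_neg]; linarith
    have hta' : ta < t₂ := by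
      refine hta.2.lt_of_ne ?_
      rintro rfl
      rw [add_neg_cancel, h0] at hxa
      linarith [hx.1]
    have htb' : tb < t₁ := by
      refine htb.2.lt_of_ne ?_
      rintro rfl
      exact hxp hxb
    rcases lt_trichotomy (t₂ - ta) (t₁ - tb) with hlt' | heq | hlt'
    · have h1 := hmeet (t₂ - ta)
      rw [show ta + (t₂ - ta) + -t₂ = 0 by ring] at h1
      have h2 := hneg₁ (tb + (t₂ - ta)) ⟨by linarith [htb.1], by linarith⟩
      rw [← h1, Prod.snd_neg, hy0] at h2
      linarith
    · have h1 := hmeet (t₂ - ta)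
      rw [show ta + (t₂ - ta) + -t₂ = 0 by ring, heq, show tb + (t₁ - tb) = t₁ by ring] at h1
      have h2 := congrArg Prod.fst h1
      rw [Prod.fst_neg, h0] at h2
      exact hne h2.symm
    · have h1 := hmeet (t₁ - tb)
      rw [show tb + (t₁ - tb) = t₁ by ring] at h1
      have h2 := hτneg (ta + (t₁ - tb)) ⟨by linarith [hta.1], by linarith⟩
      rw [h1, hyt₁] at h2
      linarith
  rw [hpb'] at A hw1 hwsurj
  refine ⟨hcb, hy0, ⟨t₁, fun t => ?_⟩, w, A, hw1, hw0, fun x hx => ?_⟩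
  · have hs : γ t₁ = -γ 0 := by
      refine Prod.ext ?_ ?_
      · rw [Prod.fst_neg, h0, ← hpb']
      · rw [Prod.snd_neg, hy0, hyt₁, neg_zero]
    have := h.eq_of_eq h.neg hs t
    rwa [zero_add, add_comm] at this
  · obtain ⟨t, ht, hxt⟩ := hwsurj x hx
    refine ⟨t, Prod.ext hxt ?_⟩
    have := hw t ht
    rw [hxt] at this
    simp only
    linarith

/-- Every limit cycle has the same range as one in normal form. -/
lemma exists_normal_form (H : Admissible a1 a2 δ) {γ : ℝ → ℝ × ℝ}
    (h : IsNonconstPeriodicSolII a1 a2 δ γ) :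
    ∃ σ b, IsNonconstPeriodicSolII a1 a2 δ σ ∧ (∀ t, |(σ t).1| ≤ b) ∧ σ 0 = (b, 0) ∧
      range σ = range γ := by
  obtain ⟨_, ⟨s, rfl⟩, hs⟩ := h.isCompact_range.exists_isMaxOn (range_nonempty γ)
    (f := fun z => |z.1|) (by fun_prop)
  have hmax : ∀ t, |(γ t).1| ≤ |(γ s).1| := fun t => hs ⟨t, rfl⟩
  have hshift : range (fun t => γ (t + s)) = range γ :=
    (Equiv.addRight s).surjective.range_comp γ
  rcases le_total 0 (γ s).1 with h0 | h0
  · refine ⟨fun t => γ (t + s), |(γ s).1|, h.shift s, fun t => hmax _, ?_, hshift⟩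
    have hx : (γ (0 + s)).1 = |(γ s).1| := by rw [zero_add, abs_of_nonneg h0]
    exact Prod.ext hx (exists_symm_arc H (h.shift s) (fun t => hmax _) hx).2.1
  · have h' : IsNonconstPeriodicSolII a1 a2 δ (fun t => -γ (t + s)) := (h.shift s).neg
    have hx : (-γ (0 + s)).1 = |(γ s).1| := by rw [zero_add, abs_of_nonpos h0, Prod.fst_neg]
    have hm : ∀ t, |(-γ (t + s)).1| ≤ |(γ s).1| := fun t => by
      rw [Prod.fst_neg, abs_neg]
      exact hmax _
    obtain ⟨-, hy, ⟨t₁, ht₁⟩, -⟩ := exists_symm_arc H h' hm hx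
    refine ⟨fun t => -γ (t + s), |(γ s).1|, h', hm, Prod.ext hx hy, ?_⟩
    rw [← hshift]
    ext z
    constructor
    · rintro ⟨t, rfl⟩
      refine ⟨t + t₁, ?_⟩
      have := ht₁ t
      exact neg_inj.1 (by simpa using this)
    · rintro ⟨t, rfl⟩
      refine ⟨t + t₁, ?_⟩
      have := ht₁ t
      simpa using this

lemma not_lt_of_normal_form (H : Admissible a1 a2 δ) {σ₁ σ₂ : ℝ → ℝ × ℝ} {b₁ b₂ : ℝ}
    (h₁ : IsNonconstPeriodicSolII a1 a2 δ σ₁) (h₂ : IsNonconstPeriodicSolII a1 a2 δ σ₂)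
    (m₁ : ∀ t, |(σ₁ t).1| ≤ b₁) (m₂ : ∀ t, |(σ₂ t).1| ≤ b₂) (e₁ : σ₁ 0 = (b₁, 0))
    (e₂ : σ₂ 0 = (b₂, 0)) : ¬ b₁ < b₂ := by
  intro hlt
  obtain ⟨c₁, -, -, w₁, A₁, l₁, r₁, s₁⟩ := exists_symm_arc H h₁ m₁ (by rw [e₁])
  obtain ⟨-, -, -, w₂, A₂, l₂, r₂, s₂⟩ := exists_symm_arc H h₂ m₂ (by rw [e₂])
  have hne : ∀ x ∈ Icc (-b₁) b₁, w₁ x ≠ w₂ x := by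
    intro x hx heq
    obtain ⟨t, ht⟩ := s₁ x hx
    obtain ⟨r, hr⟩ := s₂ x ⟨by linarith [hx.1], by linarith [hx.2]⟩
    have := h₁.eq_of_eq h₂ (t := t) (r := r) (by rw [ht, hr, heq]) (-r)
    rw [add_neg_cancel, e₂] at this
    have h3 := m₁ (t + -r)
    rw [this] at h3
    linarith [le_abs_self b₂]
  have hb₁ := A₁.lt
  have hend : w₁ b₁ < w₂ b₁ := by
    refine lt_of_le_of_ne ?_ (hne b₁ ⟨hb₁.le, le_rfl⟩)
    rw [r₁]
    exact A₂.nonneg b₁ ⟨by linarith, hlt.le⟩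
  refine A₁.not_nested H A₂ l₁ r₁ l₂ r₂ c₁ hlt fun x hx => ?_
  by_contra! hcon
  have hxl : x ≤ b₁ := hx.2
  obtain ⟨z, hz, hz0⟩ : ∃ z ∈ Icc x b₁, w₂ z - w₁ z = 0 := by
    refine intermediate_value_Icc hxl
      ((A₂.cont.mono (Icc_subset_Icc (by linarith [hx.1]) hlt.le)).sub
        (A₁.cont.mono (Icc_subset_Icc hx.1 le_rfl))) ⟨?_, ?_⟩
    · exact sub_nonpos.2 hcon
    · exact sub_nonneg.2 hend.le
  exact hne z ⟨hx.1.trans hz.1, hz.2⟩ (by linarith)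

theorem range_eq_range (H : Admissible a1 a2 δ) {γ₁ γ₂ : ℝ → ℝ × ℝ}
    (h₁ : IsNonconstPeriodicSolII a1 a2 δ γ₁) (h₂ : IsNonconstPeriodicSolII a1 a2 δ γ₂) :
    range γ₁ = range γ₂ := by
  obtain ⟨σ₁, b₁, n₁, m₁, e₁, r₁⟩ := exists_normal_form H h₁
  obtain ⟨σ₂, b₂, n₂, m₂, e₂, r₂⟩ := exists_normal_form H h₂
  have hb : b₁ = b₂ := le_antisymm (not_lt.1 (not_lt_of_normal_form H n₂ n₁ m₂ m₁ e₂ e₁))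
    (not_lt.1 (not_lt_of_normal_form H n₁ n₂ m₁ m₂ e₁ e₂))
  have := n₁.eq_of_eq n₂ (t := 0) (r := 0) (by rw [e₁, e₂, hb])
  simp only [zero_add] at this
  rw [← r₁, ← r₂, funext this]

/-! ### Global solutions of bounded Lipschitz fields -/

section Global

variable {E : Type*} [NormedAddCommGroup E] [NormedSpace ℝ E] {v : E → E} {K : NNReal}

lemma eqOn_of_hasDerivWithinAt (hv : LipschitzWith K v) {α β : ℝ → E} {m n : ℝ} (hm : 0 < m)
    (hmn : m ≤ n) (hα : ∀ t ∈ Icc (-m) m, HasDerivWithinAt α (v (α t)) (Icc (-m) m) t)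
    (hβ : ∀ t ∈ Icc (-n) n, HasDerivWithinAt β (v (β t)) (Icc (-n) n) t) (h0 : α 0 = β 0) :
    EqOn α β (Ioo (-m) m) := by
  refine ODE_solution_unique_of_mem_Ioo (v := fun _ => v) (s := fun _ => univ) (K := K)
    (fun t _ => hv.lipschitzOnWith) (t₀ := 0) ⟨by linarith, hm⟩ ?_ ?_ h0
  · exact fun t ht => ⟨(hα t (Ioo_subset_Icc_self ht)).hasDerivAt (Icc_mem_nhds ht.1 ht.2), trivial⟩
  · exact fun t ht => ⟨(hβ t ⟨by linarith [ht.1], by linarith [ht.2]⟩).hasDerivAt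
      (Icc_mem_nhds (by linarith [ht.1]) (by linarith [ht.2])), trivial⟩

lemma exists_global_solution [CompleteSpace E] (hv : LipschitzWith K v) {L : NNReal}
    (hL : ∀ z, ‖v z‖ ≤ L) (z₀ : E) : ∃ γ : ℝ → E, γ 0 = z₀ ∧ ∀ t, HasDerivAt γ (v (γ t)) t := by
  have hloc : ∀ n : ℕ, ∃ α : ℝ → E, α 0 = z₀ ∧ ∀ t ∈ Icc (-((n : ℝ) + 1)) (n + 1),
      HasDerivWithinAt α (v (α t)) (Icc (-((n : ℝ) + 1)) (n + 1)) t := by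
    intro n
    have hn : (0 : ℝ) < n + 1 := by positivity
    have hp : IsPicardLindelof (fun _ => v) (tmin := -((n : ℝ) + 1)) (tmax := n + 1)
        ⟨0, by linarith, hn.le⟩ z₀ (L * (n + 1)) 0 L K :=
      { lipschitzOnWith := fun _ _ => hv.lipschitzOnWith
        continuousOn := fun _ _ => continuousOn_const
        norm_le := fun _ _ z _ => hL z
        mul_max_le := by simp }
    obtain ⟨α, h0, h⟩ := hp.exists_eq_forall_mem_Icc_hasDerivWithinAt₀
    exact ⟨α, h0, h⟩
  choose α h0 hα using hloc
  have hagree : ∀ m n : ℕ, ∀ t ∈ Ioo (-((m : ℝ) + 1)) (m + 1), t ∈ Ioo (-((n : ℝ) + 1)) (n + 1) →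
      α m t = α n t := by
    intro m n t hm hn
    rcases le_total m n with h | h
    · exact eqOn_of_hasDerivWithinAt hv (by positivity) (by gcongr) (hα m) (hα n)
        ((h0 m).trans (h0 n).symm) hm
    · exact (eqOn_of_hasDerivWithinAt hv (by positivity) (by gcongr) (hα n) (hα m)
        ((h0 n).trans (h0 m).symm) hn).symm
  have hmem : ∀ t : ℝ, t ∈ Ioo (-((⌈|t|⌉₊ : ℝ) + 1)) (⌈|t|⌉₊ + 1) := by
    intro t
    have h1 := Nat.le_ceil |t|
    exact ⟨by linarith [neg_abs_le t], by linarith [le_abs_self t]⟩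
  refine ⟨fun t => α ⌈|t|⌉₊ t, by simp [h0], fun t => ?_⟩
  have h := (hα _ t (Ioo_subset_Icc_self (hmem t))).hasDerivAt (Icc_mem_nhds (hmem t).1 (hmem t).2)
  refine h.congr_of_eventuallyEq ?_
  filter_upwards [Ioo_mem_nhds (hmem t).1 (hmem t).2] with r hr
  exact hagree _ _ r (hmem r) hr

lemma dist_le_of_hasDerivAt (hv : LipschitzWith K v) {α β : ℝ → E}
    (hα : ∀ t, HasDerivAt α (v (α t)) t) (hβ : ∀ t, HasDerivAt β (v (β t)) t) {t : ℝ}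
    (ht : 0 ≤ t) : dist (α t) (β t) ≤ dist (α 0) (β 0) * Real.exp (K * t) := by
  have := dist_le_of_trajectories_ODE (v := fun _ => v) (K := K) (fun _ => hv)
    (f := α) (g := β) (a := 0) (b := t)
    (fun r _ => (hα r).continuousAt.continuousWithinAt) (fun r _ => (hα r).hasDerivWithinAt)
    (fun r _ => (hβ r).continuousAt.continuousWithinAt) (fun r _ => (hβ r).hasDerivWithinAt)
    le_rfl t ⟨ht, le_rfl⟩
  simpa using this

lemma eq_of_hasDerivAt (hv : LipschitzWith K v) {α β : ℝ → E}
    (hα : ∀ t, HasDerivAt α (v (α t)) t) (hβ : ∀ t, HasDerivAt β (v (β t)) t) (h : α 0 = β 0) :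
    α = β :=
  ODE_solution_unique_univ (v := fun _ => v) (s := fun _ => univ) (K := K)
    (fun _ => hv.lipschitzOnWith) (fun t => ⟨hα t, trivial⟩) (fun t => ⟨hβ t, trivial⟩) h

end Global

/-- A function which converges at infinity and whose derivative converges has derivative
tending to zero. -/
lemma eq_zero_of_tendsto_deriv {h h' : ℝ → ℝ} {l d : ℝ} (hd : ∀ t, HasDerivAt h (h' t) t)
    (h1 : Tendsto h atTop (𝓝 l)) (h2 : Tendsto h' atTop (𝓝 d)) : d = 0 := by
  have hmvt : ∀ t : ℝ, ∃ c ∈ Ioo t (t + 1), h' c = h (t + 1) - h t := by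
    intro t
    obtain ⟨c, hc, h⟩ := exists_hasDerivAt_eq_slope h h' (lt_add_one t)
      (fun r _ => (hd r).continuousAt.continuousWithinAt) (fun r _ => hd r)
    exact ⟨c, hc, by simpa using h⟩
  choose c hc hce using hmvt
  have h3 : Tendsto c atTop atTop := tendsto_atTop_mono (fun t => (hc t).1.le) tendsto_id
  have h4 := h2.comp h3
  have h5 : Tendsto (fun t => h (t + 1) - h t) atTop (𝓝 (l - l)) :=
    (h1.comp (tendsto_atTop_add_const_right _ 1 tendsto_id)).sub h1
  rw [sub_self] at h5
  exact tendsto_nhds_unique (h4.congr hce) h5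

/-! ### The truncated field -/

/-- The retraction of the line onto `[-N, N]`. -/
noncomputable def clamp (N x : ℝ) : ℝ := max (-N) (min N x)

lemma clamp_of_abs_le {N x : ℝ} (h : |x| ≤ N) : clamp N x = x := by
  rw [abs_le] at h
  rw [clamp, min_eq_right h.2, max_eq_right h.1]

lemma abs_clamp_le {N : ℝ} (hN : 0 ≤ N) (x : ℝ) : |clamp N x| ≤ N :=
  abs_le.2 ⟨le_max_left _ _, max_le (by linarith) (min_le_left _ _)⟩

lemma clamp_neg (N : ℝ) (hN : 0 ≤ N) (x : ℝ) : clamp N (-x) = -clamp N x := by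
  unfold clamp
  rcases le_total x N with h | h <;> rcases le_total (-N) x with h' | h'
  · rw [min_eq_right h, min_eq_right (by linarith), max_eq_right h', max_eq_right (by linarith)]
  · rw [min_eq_right h, min_eq_left (by linarith), max_eq_left h', max_eq_right (by linarith),
      neg_neg]
  · rw [min_eq_left h, min_eq_right (by linarith), max_eq_left (by linarith),
      max_eq_right (by linarith)]
  · rw [show N = 0 by linarith, show x = 0 by linarith]
    simp

lemma lipschitzWith_clamp (N : ℝ) : LipschitzWith 1 (clamp N) :=
  (LipschitzWith.id.const_min N).const_max (-N)

/-- The field of (II) made bounded by freezing it outside a square. -/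
noncomputable def truncField (a1 a2 δ N : ℝ) (z : ℝ × ℝ) : ℝ × ℝ :=
  field a1 a2 δ (clamp N z.1, clamp N z.2)

lemma truncField_of_norm_le {N : ℝ} {z : ℝ × ℝ} (h : ‖z‖ ≤ N) :
    truncField a1 a2 δ N z = field a1 a2 δ z := by
  rw [truncField, clamp_of_abs_le ((norm_fst_le z).trans h),
    clamp_of_abs_le ((norm_snd_le z).trans h)]

lemma truncField_neg {N : ℝ} (hN : 0 ≤ N) (z : ℝ × ℝ) :
    truncField a1 a2 δ N (-z) = -truncField a1 a2 δ N z := by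
  rw [truncField, truncField, ← field_neg, Prod.fst_neg, Prod.snd_neg, clamp_neg N hN,
    clamp_neg N hN, Prod.neg_mk]

lemma clamp_mem_closedBall {N : ℝ} (hN : 0 ≤ N) (z : ℝ × ℝ) :
    (clamp N z.1, clamp N z.2) ∈ Metric.closedBall (0 : ℝ × ℝ) N := by
  rw [mem_closedBall_zero_iff]
  exact max_le (abs_clamp_le hN _) (abs_clamp_le hN _)

lemma exists_lipschitzWith_truncField (a1 a2 δ : ℝ) {N : ℝ} (hN : 0 ≤ N) :
    ∃ K, LipschitzWith K (truncField a1 a2 δ N) := by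
  obtain ⟨K, hK⟩ := (contDiff_field a1 a2 δ).contDiffOn.exists_lipschitzOnWith one_ne_zero
    (convex_closedBall (0 : ℝ × ℝ) N) (isCompact_closedBall (0 : ℝ × ℝ) N)
  have hc : LipschitzWith 1 fun z : ℝ × ℝ => (clamp N z.1, clamp N z.2) := by
    have := ((lipschitzWith_clamp N).comp (LipschitzWith.prod_fst (α := ℝ) (β := ℝ))).prodMk
      ((lipschitzWith_clamp N).comp (LipschitzWith.prod_snd (α := ℝ) (β := ℝ)))
    simpa using this
  have := hK.comp (f := fun z : ℝ × ℝ => (clamp N z.1, clamp N z.2)) (s := univ)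
    hc.lipschitzOnWith (fun z _ => clamp_mem_closedBall hN z)
  exact ⟨K * 1, lipschitzOnWith_univ.1 this⟩

lemma exists_norm_truncField_le (a1 a2 δ : ℝ) {N : ℝ} (hN : 0 ≤ N) :
    ∃ L : NNReal, ∀ z, ‖truncField a1 a2 δ N z‖ ≤ L := by
  obtain ⟨L, hL⟩ := (isCompact_closedBall (0 : ℝ × ℝ) N).exists_bound_of_continuousOn
    (contDiff_field a1 a2 δ).continuous.continuousOn
  exact ⟨L.toNNReal, fun z => (hL _ (clamp_mem_closedBall hN z)).trans (le_max_left _ _)⟩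

lemma exists_solution_truncField (a1 a2 δ : ℝ) {N : ℝ} (hN : 0 ≤ N) (z₀ : ℝ × ℝ) :
    ∃ γ : ℝ → ℝ × ℝ, γ 0 = z₀ ∧ ∀ t, HasDerivAt γ (truncField a1 a2 δ N (γ t)) t := by
  obtain ⟨K, hK⟩ := exists_lipschitzWith_truncField a1 a2 δ hN
  obtain ⟨L, hL⟩ := exists_norm_truncField_le a1 a2 δ hN
  exact exists_global_solution hK hL z₀

/-! ### A priori bounds for arcs -/

/-- A modified energy `2 E + 4` dominating the square of the abscissa. -/
noncomputable def energySq (a1 : ℝ) (w : ℝ → ℝ) (x : ℝ) : ℝ := w x ^ 2 + 2 * potential a1 x + 4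

/-- The square root of `energySq`. -/
noncomputable def radius (a1 : ℝ) (w : ℝ → ℝ) (x : ℝ) : ℝ := √(energySq a1 w x)

lemma sq_le_two_mul_potential (H : Admissible a1 a2 δ) (x : ℝ) :
    x ^ 2 < 2 * potential a1 x + 4 := by
  have h1 : 0 < x ^ 6 / 3 - x ^ 4 + 4 - x ^ 2 := by
    nlinarith [mul_nonneg (sq_nonneg x) (sq_nonneg (x ^ 2 - 5 / 2)),
      sq_nonneg (x ^ 2 - 5 / 2), sq_nonneg x, sq_nonneg (x ^ 2 - 12 / 5),
      mul_nonneg (sq_nonneg x) (sq_nonneg (x ^ 2 - 12 / 5))]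
  have h2 : 0 < x ^ 6 / 3 - x ^ 4 / 2 + 4 - x ^ 2 := by
    nlinarith [mul_nonneg (sq_nonneg x) (sq_nonneg (x ^ 2 - 3 / 2)),
      sq_nonneg (x ^ 2 - 3 / 2), sq_nonneg x]
  have h3 := H.neg_one_lt
  have h4 := H.neg
  unfold potential
  nlinarith [mul_pos (neg_pos.2 h4) h1, mul_pos (show 0 < 1 + a1 by linarith) h2]

lemma two_mul_potential_le (H : Admissible a1 a2 δ) {x M : ℝ} (h : |x| ≤ M) :
    2 * potential a1 x + 4 ≤ M ^ 6 + M ^ 2 + 4 := by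
  have h1 : x ^ 6 ≤ M ^ 6 := by
    rw [← (by decide : Even 6).pow_abs]
    exact pow_le_pow_left₀ (abs_nonneg x) h 6
  have h2 : x ^ 2 ≤ M ^ 2 := by
    rw [← sq_abs]
    exact pow_le_pow_left₀ (abs_nonneg x) h 2
  have h3 : 0 ≤ x ^ 6 := by positivity
  unfold potential
  nlinarith [mul_nonneg (show 0 ≤ 1 - a1 by linarith [H.neg]) (show 0 ≤ x ^ 4 by positivity),
    mul_nonneg (show 0 ≤ 1 + a1 by linarith [H.neg_one_lt]) (sq_nonneg x)]

lemma energySq_pos (H : Admissible a1 a2 δ) (w : ℝ → ℝ) (x : ℝ) : 0 < energySq a1 w x := by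
  have := sq_le_two_mul_potential H x
  unfold energySq
  nlinarith [sq_nonneg (w x), sq_nonneg x]

lemma radius_pos (H : Admissible a1 a2 δ) (w : ℝ → ℝ) (x : ℝ) : 0 < radius a1 w x :=
  Real.sqrt_pos.2 (energySq_pos H w x)

lemma radius_sq (H : Admissible a1 a2 δ) (w : ℝ → ℝ) (x : ℝ) :
    radius a1 w x ^ 2 = energySq a1 w x := Real.sq_sqrt (energySq_pos H w x).le

lemma abs_le_radius (H : Admissible a1 a2 δ) (w : ℝ → ℝ) (x : ℝ) : |x| ≤ radius a1 w x := by
  apply Real.abs_le_sqrt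
  have := sq_le_two_mul_potential H x
  unfold energySq
  nlinarith [sq_nonneg (w x)]

lemma le_radius (H : Admissible a1 a2 δ) (w : ℝ → ℝ) (x : ℝ) : w x ≤ radius a1 w x := by
  refine (le_abs_self _).trans (Real.abs_le_sqrt ?_)
  have := sq_le_two_mul_potential H x
  unfold energySq
  nlinarith [sq_nonneg x]

lemma neg_le_damping (H : Admissible a1 a2 δ) (x : ℝ) : δ * a2 ≤ damping a2 δ x := by
  unfold damping
  nlinarith [mul_nonneg H.pos.le (sq_nonneg x)]

namespace IsArc

variable {w : ℝ → ℝ} {p b : ℝ}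

lemma continuousOn_radius (A : IsArc a1 a2 δ w p b) : ContinuousOn (radius a1 w) (Icc p b) := by
  refine ContinuousOn.sqrt (ContinuousOn.add (ContinuousOn.add (A.cont.pow 2) ?_) continuousOn_const)
  exact fun x _ => ((hasDerivAt_potential a1 x).const_mul 2).continuousAt.continuousWithinAt

lemma hasDerivAt_radius (A : IsArc a1 a2 δ w p b) (H : Admissible a1 a2 δ) {x : ℝ}
    (hx : x ∈ Ioo p b) :
    HasDerivAt (radius a1 w) (damping a2 δ x * (w x / radius a1 w x)) x := by
  have h := (((A.deriv x hx).pow 2).add ((hasDerivAt_potential a1 x).const_mul 2)).add_const 4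
  have := h.sqrt (energySq_pos H w x).ne'
  refine this.congr_deriv ?_
  have p1 := (A.pos x hx).ne'
  have p2 := (radius_pos H w x).ne'
  change _ / (2 * radius a1 w x) = _
  field_simp
  norm_num
  ring

lemma div_radius_mem (A : IsArc a1 a2 δ w p b) (H : Admissible a1 a2 δ) {x : ℝ}
    (hx : x ∈ Ioo p b) : 0 < w x / radius a1 w x ∧ w x / radius a1 w x ≤ 1 :=
  ⟨div_pos (A.pos x hx) (radius_pos H w x), (div_le_one (radius_pos H w x)).2 (le_radius H w x)⟩

/-- A tool to compare the radius with a function whose derivative is known. -/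
lemma monotoneOn_radius_sub (A : IsArc a1 a2 δ w p b) (H : Admissible a1 a2 δ) {φ φ' : ℝ → ℝ}
    (hφ : ∀ x, HasDerivAt φ (φ' x) x)
    (h : ∀ x ∈ Ioo p b, φ' x ≤ damping a2 δ x * (w x / radius a1 w x)) :
    MonotoneOn (fun x => radius a1 w x - φ x) (Icc p b) := by
  refine monotoneOn_of_deriv_nonneg (convex_Icc p b)
    (A.continuousOn_radius.sub fun x _ => (hφ x).continuousAt.continuousWithinAt) ?_ ?_
  · intro x hx
    rw [interior_Icc] at hx
    exact ((A.hasDerivAt_radius H hx).sub (hφ x)).differentiableAt.differentiableWithinAt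
  · intro x hx
    rw [interior_Icc] at hx
    refine (sub_nonneg.2 (h x hx)).trans_eq ?_
    exact ((A.hasDerivAt_radius H hx).sub (hφ x)).deriv.symm

/-- Where the damping is nonnegative the radius increases with the abscissa. -/
lemma radius_le_of_sqrt_le (A : IsArc a1 a2 δ w p b) (H : Admissible a1 a2 δ)
    (h : ∀ x ∈ Ioo p b, √(-a2) ≤ |x|) : radius a1 w p ≤ radius a1 w b := by
  have := A.monotoneOn_radius_sub H (φ := fun _ => 0) (fun x => hasDerivAt_const x 0)
    (fun x hx => mul_nonneg (H.damping_nonneg_of_le_abs (h x hx)) (A.div_radius_mem H hx).1.le)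
    ⟨le_rfl, A.lt.le⟩ ⟨A.lt.le, le_rfl⟩ A.lt.le
  simpa using this

lemma radius_le_add (A : IsArc a1 a2 δ w p b) (H : Admissible a1 a2 δ) :
    radius a1 w p ≤ radius a1 w b - δ * a2 * (b - p) := by
  have hlin : ∀ x, HasDerivAt (fun x => δ * a2 * x) (δ * a2) x := fun x => by
    simpa using (hasDerivAt_id x).const_mul (δ * a2)
  have := A.monotoneOn_radius_sub H (φ := fun x => δ * a2 * x) hlin
    (fun x hx => ?_) ⟨le_rfl, A.lt.le⟩ ⟨A.lt.le, le_rfl⟩ A.lt.le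
  · simp only at this
    linarith
  · have h1 := A.div_radius_mem H hx
    have h2 := neg_le_damping H x
    have h3 : δ * a2 ≤ 0 := mul_nonpos_of_nonneg_of_nonpos H.pos.le (by linarith [H.le_neg_one])
    nlinarith [mul_nonneg h1.1.le (sub_nonneg.2 h2), mul_nonneg (neg_nonneg.2 h3) (sub_nonneg.2 h1.2)]

/-- The radius at the left end is bounded in terms of the right end only. -/
lemma radius_le (A : IsArc a1 a2 δ w p b) (H : Admissible a1 a2 δ) {m : ℝ} (hm : √(-a2) ≤ m)
    (hb : b ≤ m) : radius a1 w p ≤ radius a1 w b - δ * a2 * (m + √(-a2)) := by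
  have hc := H.one_le_sqrt
  have h3 : δ * a2 ≤ 0 := mul_nonpos_of_nonneg_of_nonpos H.pos.le (by linarith [H.le_neg_one])
  rcases le_or_gt (-√(-a2)) p with h | h
  · have := A.radius_le_add H
    nlinarith
  rcases le_or_gt b (-√(-a2)) with h' | h'
  · have := A.radius_le_of_sqrt_le H (fun x hx => le_abs.2 (Or.inr (by linarith [hx.2])))
    nlinarith
  · have h1 := (A.mono h le_rfl h'.le).radius_le_of_sqrt_le H
      (fun x hx => le_abs.2 (Or.inr (by linarith [hx.2])))
    have h2 := (A.mono h' h.le le_rfl).radius_le_add H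
    nlinarith

end IsArc

lemma dampingPrim_sqrt (H : Admissible a1 a2 δ) :
    dampingPrim a2 δ √(-a2) = -(2 * δ * √(-a2) ^ 3 / 3) ∧
    dampingPrim a2 δ (2 * √(-a2)) = 2 * δ * √(-a2) ^ 3 / 3 := by
  have h : a2 = -√(-a2) ^ 2 := by rw [H.sqrt_sq', neg_neg]
  unfold dampingPrim
  constructor
  · nth_rewrite 1 [h]
    ring
  · nth_rewrite 1 [h]
    ring

lemma dampingPrim_neg (a2 δ x : ℝ) : dampingPrim a2 δ (-x) = -dampingPrim a2 δ x := by
  unfold dampingPrim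
  ring

/-- Abscissa beyond which arcs contract. -/
noncomputable def farBound (a2 δ : ℝ) : ℝ :=
  2 * √(-a2) + √(2 * ((2 * √(-a2)) ^ 6 + (2 * √(-a2)) ^ 2 + 4)) - δ * a2 * (3 * √(-a2)) + 1

lemma two_mul_sqrt_lt_farBound (H : Admissible a1 a2 δ) : 2 * √(-a2) < farBound a2 δ := by
  have h3 : δ * a2 ≤ 0 := mul_nonpos_of_nonneg_of_nonpos H.pos.le (by linarith [H.le_neg_one])
  have := Real.sqrt_nonneg (2 * ((2 * √(-a2)) ^ 6 + (2 * √(-a2)) ^ 2 + 4))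
  unfold farBound
  nlinarith [H.one_le_sqrt]

/-- An arc starting at the far bound does not land further away. -/
lemma IsArc.neg_le_of_farBound {w : ℝ → ℝ} {p : ℝ} (A : IsArc a1 a2 δ w p (farBound a2 δ))
    (H : Admissible a1 a2 δ) (hw : w (farBound a2 δ) = 0) (hwp : w p = 0) :
    -farBound a2 δ ≤ p := by
  have hB := two_mul_sqrt_lt_farBound H
  set c := √(-a2) with hc
  set B := farBound a2 δ with hBdef
  have hc1 : 1 ≤ c := H.one_le_sqrt
  by_contra! hp
  have hK : δ * a2 ≤ 0 := mul_nonpos_of_nonneg_of_nonpos H.pos.le (by linarith [H.le_neg_one])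
  have hBval : B = 2 * c + √(2 * ((2 * c) ^ 6 + (2 * c) ^ 2 + 4)) - δ * a2 * (3 * c) + 1 := rfl
  by_cases hcase : ∃ x, |x| ≤ 2 * c ∧ w x < radius a1 w x / 2
  · obtain ⟨x, hx, hwx⟩ := hcase
    have hxb := abs_le.1 hx
    have hA := (A.mono (p' := p) (b' := x) (by linarith) le_rfl (by linarith)).radius_le H
      (m := 2 * c) (by linarith) hxb.2
    have hr := radius_sq H w x
    have hr0 := radius_pos H w x
    have hM := two_mul_potential_le H hx
    have hwn := A.nonneg x ⟨by linarith, by linarith⟩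
    have h1 : radius a1 w x ^ 2 ≤ 2 * ((2 * c) ^ 6 + (2 * c) ^ 2 + 4) := by
      unfold energySq at hr
      nlinarith
    have h2 := Real.le_sqrt_of_sq_le h1
    have h3 := (neg_le_abs p).trans (abs_le_radius H w p)
    linarith
  · push Not at hcase
    have hhalf : ∀ x, |x| ≤ 2 * c → 1 / 2 ≤ w x / radius a1 w x := fun x hx => by
      rw [le_div_iff₀ (radius_pos H w x)]
      linarith [hcase x hx]
    have hF := dampingPrim_sqrt H
    have hF' : ∀ x, HasDerivAt (fun x => dampingPrim a2 δ x / 2) (damping a2 δ x / 2) x :=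
      fun x => (hasDerivAt_dampingPrim a2 δ x).div_const 2
    have s1 := (A.mono (p' := 2 * c) (b' := B) hB (by linarith) le_rfl).radius_le_of_sqrt_le H
      (fun x hx => le_abs.2 (Or.inl (by linarith [hx.1])))
    have A2 := A.mono (p' := c) (b' := 2 * c) (by linarith) (by linarith) hB.le
    have s2 := A2.monotoneOn_radius_sub H hF' (fun x hx => by
      have e1 := hhalf x (abs_le.2 ⟨by linarith [hx.1], hx.2.le⟩)
      have e2 := H.damping_nonneg_of_le_abs (x := x) (le_abs.2 (Or.inl hx.1.le))
      nlinarith) ⟨le_rfl, A2.lt.le⟩ ⟨A2.lt.le, le_rfl⟩ A2.lt.le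
    have A3 := A.mono (p' := -c) (b' := c) (by linarith) (by linarith) (by linarith)
    have s3 := A3.monotoneOn_radius_sub H (hasDerivAt_dampingPrim a2 δ) (fun x hx => by
      have e1 := (A3.div_radius_mem H hx).2
      have e2 := H.damping_nonpos_of_abs_le (x := x) (abs_le.2 ⟨hx.1.le, hx.2.le⟩)
      nlinarith) ⟨le_rfl, A3.lt.le⟩ ⟨A3.lt.le, le_rfl⟩ A3.lt.le
    have A4 := A.mono (p' := -(2 * c)) (b' := -c) (by linarith) (by linarith) (by linarith)
    have s4 := A4.monotoneOn_radius_sub H hF' (fun x hx => by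
      have e1 := hhalf x (abs_le.2 ⟨hx.1.le, by linarith [hx.2]⟩)
      have e2 := H.damping_nonneg_of_le_abs (x := x) (le_abs.2 (Or.inr (by linarith [hx.2])))
      nlinarith) ⟨le_rfl, A4.lt.le⟩ ⟨A4.lt.le, le_rfl⟩ A4.lt.le
    have A5 := A.mono (p' := p) (b' := -(2 * c)) (by linarith) le_rfl (by linarith)
    have s5 := A5.radius_le_of_sqrt_le H (fun x hx => le_abs.2 (Or.inr (by linarith [hx.2])))
    simp only [dampingPrim_neg] at s3 s4
    have hle : radius a1 w p ≤ radius a1 w B := by linarith [hF.1, hF.2]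
    have h2 : energySq a1 w p ≤ energySq a1 w B := by
      rw [← radius_sq H, ← radius_sq H]
      exact pow_le_pow_left₀ (radius_pos H w p).le hle 2
    have hmono : StrictMonoOn (potential a1) (Ici 1) := by
      refine strictMonoOn_of_deriv_pos (convex_Ici 1)
        (fun x _ => (hasDerivAt_potential a1 x).continuousAt.continuousWithinAt) ?_
      intro x hx
      rw [interior_Ici] at hx
      rw [(hasDerivAt_potential a1 x).deriv]
      exact force_pos_of_one_lt H.neg_one_lt hx
    have h3 := hmono (a := B) (b := -p) (by simp; linarith) (by simp; linarith) (by linarith)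
    rw [potential_neg] at h3
    unfold energySq at h2
    rw [hw, hwp] at h2
    linarith

/-! ### The half return map -/

/-- A bound for orbits in the lower half plane starting from `[√(-a2), B] × {0}`. -/
noncomputable def boxBound (a2 δ B : ℝ) : ℝ :=
  √(B ^ 6 + B ^ 2 + 4) - δ * a2 * (B + √(-a2)) + 1

lemma boxBound_pos (H : Admissible a1 a2 δ) {B : ℝ} (hB : √(-a2) ≤ B) : 0 < boxBound a2 δ B := by
  have h3 : δ * a2 ≤ 0 := mul_nonpos_of_nonneg_of_nonpos H.pos.le (by linarith [H.le_neg_one])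
  have := Real.sqrt_nonneg (B ^ 6 + B ^ 2 + 4)
  unfold boxBound
  nlinarith [H.one_le_sqrt]

lemma lt_boxBound (H : Admissible a1 a2 δ) {B : ℝ} (hB : √(-a2) ≤ B) : B < boxBound a2 δ B := by
  have h3 : δ * a2 ≤ 0 := mul_nonpos_of_nonneg_of_nonpos H.pos.le (by linarith [H.le_neg_one])
  have : B ≤ √(B ^ 6 + B ^ 2 + 4) := Real.le_sqrt_of_sq_le (by nlinarith [sq_nonneg (B ^ 3)])
  unfold boxBound
  nlinarith [H.one_le_sqrt]

/-- An orbit of the truncated system starting on the positive axis. -/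
structure Shot (a1 a2 δ B b : ℝ) (γ : ℝ → ℝ × ℝ) : Prop where
  sqrt_le : √(-a2) ≤ b
  le : b ≤ B
  fold_le : fold a1 (π / 3) ≤ b
  init : γ 0 = (b, 0)
  deriv : ∀ t, HasDerivAt γ (truncField a1 a2 δ (boxBound a2 δ B) (γ t)) t

namespace Shot

variable {B b : ℝ} {γ : ℝ → ℝ × ℝ}

lemma continuous (S : Shot a1 a2 δ B b γ) : Continuous γ := continuous_of_hasDerivAt S.deriv

lemma one_lt (S : Shot a1 a2 δ B b γ) (H : Admissible a1 a2 δ) : 1 < b :=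
  (one_lt_fold H).trans_le S.fold_le

lemma boxBound_pos (S : Shot a1 a2 δ B b γ) (H : Admissible a1 a2 δ) : 0 < boxBound a2 δ B :=
  SystemII.boxBound_pos H (S.sqrt_le.trans S.le)

lemma norm_lt_of_field (S : Shot a1 a2 δ B b γ) (H : Admissible a1 a2 δ) {t₀ : ℝ} (h0 : 0 < t₀)
    (hγ : ∀ t ∈ Icc 0 t₀, HasDerivAt γ (field a1 a2 δ (γ t)) t)
    (hy : ∀ t ∈ Ioo 0 t₀, (γ t).2 < 0) : ‖γ t₀‖ < boxBound a2 δ B := by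
  obtain ⟨w, A, hw, -⟩ := exists_isArc h0 hγ hy
  have hw0 := hw 0 ⟨le_rfl, h0.le⟩
  have hw1 := hw t₀ ⟨h0.le, le_rfl⟩
  rw [S.init] at A hw0
  simp only [neg_zero] at A hw0
  have h1 := A.radius_le H (S.sqrt_le.trans S.le) S.le
  have hb0 : |b| ≤ B := by
    rw [abs_of_pos (by linarith [S.one_lt H])]
    exact S.le
  have h2 : radius a1 w b ≤ √(B ^ 6 + B ^ 2 + 4) := by
    refine Real.sqrt_le_sqrt ?_
    have := two_mul_potential_le H hb0
    unfold energySq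
    rw [hw0]
    linarith
  have h3 := abs_le_radius H w (γ t₀).1
  have h4 := le_radius H w (γ t₀).1
  have h5 := A.nonneg (γ t₀).1 ⟨le_rfl, A.lt.le⟩
  rw [hw1] at h4 h5
  refine max_lt ?_ ?_
  · rw [Real.norm_eq_abs]
    unfold boxBound
    linarith
  · rw [Real.norm_eq_abs, abs_of_nonpos (by linarith)]
    unfold boxBound
    linarith

lemma norm_lt (S : Shot a1 a2 δ B b γ) (H : Admissible a1 a2 δ) {T : ℝ}
    (hy : ∀ t ∈ Ioo 0 T, (γ t).2 < 0) : ∀ t ∈ Icc 0 T, ‖γ t‖ < boxBound a2 δ B := by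
  by_contra! hcon
  obtain ⟨t, ht, hnt⟩ := hcon
  have hcomp : IsCompact (Icc 0 T ∩ (fun t => ‖γ t‖) ⁻¹' Ici (boxBound a2 δ B)) :=
    isCompact_Icc.inter_right (isClosed_Ici.preimage S.continuous.norm)
  obtain ⟨t₀, ⟨⟨h1, h2⟩, h3⟩, h4⟩ := hcomp.exists_isLeast ⟨t, ht, hnt⟩
  have hle : ∀ r ∈ Ico 0 t₀, ‖γ r‖ < boxBound a2 δ B := by
    intro r hr
    by_contra! hcon
    linarith [h4 ⟨⟨hr.1, hr.2.le.trans h2⟩, hcon⟩, hr.2]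
  have hb := S.one_lt H
  have hpos : 0 < t₀ := by
    refine h1.lt_of_ne ?_
    rintro rfl
    have h5 : ‖γ 0‖ < boxBound a2 δ B := by
      rw [S.init, Prod.norm_mk, norm_zero, Real.norm_eq_abs, abs_of_pos (by linarith)]
      exact max_lt (S.le.trans_lt (lt_boxBound H (S.sqrt_le.trans S.le))) (S.boxBound_pos H)
    exact absurd h3 (not_le.2 h5)
  have hcl : ∀ r ∈ Icc 0 t₀, ‖γ r‖ ≤ boxBound a2 δ B := by
    intro r hr
    rw [← closure_Ico hpos.ne] at hr
    exact closure_minimal (s := Ico 0 t₀) (t := (fun t => ‖γ t‖) ⁻¹' Iic (boxBound a2 δ B))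
      (fun t ht => (hle t ht).le) (isClosed_Iic.preimage S.continuous.norm) hr
  refine absurd h3 (not_le.2 (S.norm_lt_of_field H hpos (fun r hr => ?_)
    (fun r hr => hy r ⟨hr.1, hr.2.trans_le h2⟩)))
  rw [← truncField_of_norm_le (hcl r hr)]
  exact S.deriv r

lemma hasDerivAt (S : Shot a1 a2 δ B b γ) (H : Admissible a1 a2 δ) {T : ℝ}
    (hy : ∀ t ∈ Ioo 0 T, (γ t).2 < 0) : ∀ t ∈ Icc 0 T, HasDerivAt γ (field a1 a2 δ (γ t)) t := by
  intro t ht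
  rw [← truncField_of_norm_le (S.norm_lt H hy t ht).le]
  exact S.deriv t

/-- Orbits do not pass through equilibria. -/
lemma field_ne_zero (S : Shot a1 a2 δ B b γ) (H : Admissible a1 a2 δ) {t : ℝ}
    (hx : (γ t).1 ≠ b) : truncField a1 a2 δ (boxBound a2 δ B) (γ t) ≠ 0 := by
  intro h
  obtain ⟨K, hK⟩ := exists_lipschitzWith_truncField a1 a2 δ (S.boxBound_pos H).le
  have := eq_of_hasDerivAt hK (α := fun r => γ (r + t)) (β := fun _ => γ t)
    (fun r => (S.deriv (r + t)).comp_add_const r t)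
    (fun r => by simpa only [h] using hasDerivAt_const r (γ t)) (by simp)
  have h1 := congrFun this (-t)
  simp only [neg_add_cancel, S.init] at h1
  rw [← h1] at hx
  exact hx rfl

/-- A shot which lands in finite time lands beyond the region of negative damping. -/
lemma land_lt (S : Shot a1 a2 δ B b γ) (H : Admissible a1 a2 δ) {t₁ : ℝ} (h1 : 0 < t₁)
    (hy : ∀ t ∈ Ioo 0 t₁, (γ t).2 < 0) (hy1 : (γ t₁).2 = 0) : (γ t₁).1 < -√(-a2) := by
  have hγ := S.hasDerivAt H hy
  obtain ⟨w, A, hw, -⟩ := exists_isArc h1 hγ hy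
  have hw1 := hw t₁ ⟨h1.le, le_rfl⟩
  rw [hy1, neg_zero] at hw1
  rw [S.init] at A
  have hd := hasDerivAt_snd (hγ t₁ ⟨h1.le, le_rfl⟩)
  have hn := nonneg_of_hasDerivAt_left hd hy1 h1 hy
  have hne : force a1 (γ t₁).1 ≠ 0 := by
    intro h
    refine S.field_ne_zero H (t := t₁) A.lt.ne ?_
    rw [truncField_of_norm_le (S.norm_lt H hy t₁ ⟨h1.le, le_rfl⟩).le, field, hy1, h]
    simp
  simp only [field, hy1, mul_zero, sub_zero] at hn
  have hneg : force a1 (γ t₁).1 < 0 := lt_of_le_of_ne (by linarith) hne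
  refine A.lt_neg_sqrt H hw1 S.sqrt_le ?_
  by_contra! hs
  obtain ⟨h2, h3⟩ := lt_and_lt_one_of_force_neg H hs hneg
  obtain ⟨θ, hθ0, hθ1, hθ⟩ := exists_fold_eq_of_lt_one h2.le h3
  have hle : fold a1 θ ≤ fold a1 (π / 3) :=
    (fold_strictMonoOn H.neg_one_lt H.neg).monotoneOn ⟨by linarith, hθ1⟩
      ⟨by linarith, le_rfl⟩ hθ1
  have h4 := A.fold_lt H hθ0 hθ1 hθ.ge (hle.trans S.fold_le)
  rw [hθ, hw1] at h4
  have h5 : fold a1 (-θ) < fold a1 θ :=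
    fold_strictMonoOn H.neg_one_lt H.neg ⟨by linarith, by linarith⟩ ⟨by linarith, hθ1⟩
      (by linarith)
  linarith [A.nonneg (fold a1 θ) ⟨by linarith, hle.trans S.fold_le⟩]

end Shot

lemma continuous_potential (a1 : ℝ) : Continuous (potential a1) := by
  unfold potential
  fun_prop

lemma continuous_truncField (a1 a2 δ : ℝ) {N : ℝ} (hN : 0 ≤ N) :
    Continuous (truncField a1 a2 δ N) :=
  (exists_lipschitzWith_truncField a1 a2 δ hN).choose_spec.continuous

lemma eq_of_force_eq_zero (H : Admissible a1 a2 δ) {x : ℝ} (h : force a1 x = 0) :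
    x = 1 ∨ x = √(-a1) ∨ |x| ≤ 1 ∧ x < √(-a1) := by
  have h1 := H.sqrt_sq
  have h0 := H.sqrt_pos
  have h2 := H.sqrt_lt_one
  unfold force at h
  rw [mul_eq_zero, mul_eq_zero] at h
  rcases h with (h | h) | h
  · exact Or.inr (Or.inr ⟨by simp [h], by linarith⟩)
  · have : (x - √(-a1)) * (x + √(-a1)) = 0 := by linarith
    rcases mul_eq_zero.1 this with h | h
    · exact Or.inr (Or.inl (by linarith))
    · exact Or.inr (Or.inr ⟨abs_le.2 ⟨by linarith, by linarith⟩, by linarith⟩)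
  · have : (x - 1) * (x + 1) = 0 := by linarith
    rcases mul_eq_zero.1 this with h | h
    · exact Or.inl (by linarith)
    · exact Or.inr (Or.inr ⟨abs_le.2 ⟨by linarith, by linarith⟩, by linarith⟩)

lemma hasDerivAt_energy_of_field {γ : ℝ → ℝ × ℝ} {t : ℝ}
    (h : HasDerivAt γ (field a1 a2 δ (γ t)) t) :
    HasDerivAt (fun t => (γ t).2 ^ 2 / 2 + potential a1 (γ t).1)
      (-damping a2 δ (γ t).1 * (γ t).2 ^ 2) t := by
  have h2 := ((hasDerivAt_snd h).pow 2).div_const 2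
  have h1 := (hasDerivAt_potential a1 (γ t).1).scomp t (hasDerivAt_fst h)
  refine (h2.add h1).congr_deriv ?_
  simp only [field, smul_eq_mul]
  norm_num
  ring

/-- A monotone bounded function on a half line converges. -/
lemma exists_tendsto_of_monotoneOn {h : ℝ → ℝ} {C : ℝ} (hm : MonotoneOn h (Ici 0))
    (hC : ∀ t, 0 ≤ t → h t ≤ C) : ∃ l, Tendsto h atTop (𝓝 l) ∧ ∀ t, 0 ≤ t → h t ≤ l := by
  have h1 : Monotone fun t => h (max t 0) := fun r t hrt =>
    hm (mem_Ici.2 (le_max_right r 0)) (mem_Ici.2 (le_max_right t 0)) (max_le_max hrt le_rfl)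
  have h2 : BddAbove (range fun t => h (max t 0)) :=
    ⟨C, by rintro _ ⟨t, rfl⟩; exact hC _ (le_max_right _ _)⟩
  refine ⟨_, (tendsto_atTop_ciSup h1 h2).congr' ?_, fun t ht => ?_⟩
  · filter_upwards [eventually_ge_atTop 0] with t ht
    rw [max_eq_left ht]
  · have := le_ciSup h2 t
    simpa only [max_eq_left ht] using this

namespace Shot

variable {B b : ℝ} {γ : ℝ → ℝ × ℝ}

/-- A shot staying in the lower half plane converges to an equilibrium. -/
lemma exists_limit (S : Shot a1 a2 δ B b γ) (H : Admissible a1 a2 δ)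
    (hy : ∀ t, 0 < t → (γ t).2 < 0) :
    ∃ l, Tendsto (fun t => (γ t).1) atTop (𝓝 l) ∧ Tendsto (fun t => (γ t).2) atTop (𝓝 0) ∧
      force a1 l = 0 ∧ ∀ t, 0 ≤ t → l < (γ t).1 := by
  set N := boxBound a2 δ B with hN
  have hN0 := S.boxBound_pos H
  have hbox : ∀ t, 0 ≤ t → ‖γ t‖ < N := fun t ht =>
    S.norm_lt H (T := t) (fun r hr => hy r hr.1) t ⟨ht, le_rfl⟩
  have hγ : ∀ t, 0 ≤ t → HasDerivAt γ (field a1 a2 δ (γ t)) t := fun t ht =>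
    S.hasDerivAt H (T := t) (fun r hr => hy r hr.1) t ⟨ht, le_rfl⟩
  have hx : ∀ t, 0 ≤ t → |(γ t).1| ≤ N := fun t ht => (norm_fst_le _).trans (hbox t ht).le
  have hy' : ∀ t, 0 ≤ t → |(γ t).2| ≤ N := fun t ht => (norm_snd_le _).trans (hbox t ht).le
  have hanti : StrictAntiOn (fun t => (γ t).1) (Ici 0) := fun r hr t ht hrt =>
    strictAntiOn_fst (fun q hq => hγ q hq.1) (fun q hq => hy q hq.1) (t₁ := t) ⟨hr, hrt.le⟩
      ⟨ht, le_rfl⟩ hrt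
  obtain ⟨l', hl', hll⟩ := exists_tendsto_of_monotoneOn (h := fun t => -(γ t).1) (C := N)
    (fun r hr t ht hrt => neg_le_neg (hanti.antitoneOn hr ht hrt))
    (fun t ht => (neg_le_abs _).trans (hx t ht))
  have hl : Tendsto (fun t => (γ t).1) atTop (𝓝 (-l')) := by simpa using hl'.neg
  have hgt : ∀ t, 0 ≤ t → -l' < (γ t).1 := by
    intro t ht
    have h1 := hanti (a := t) (b := t + 1) ht (by simp; linarith) (by linarith)
    have h2 := hll (t + 1) (by linarith)
    simp only at h1
    linarith
  set C := δ * (N ^ 2 - a2) * N with hC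
  have hCf : ∀ t, 0 ≤ t → |damping a2 δ (γ t).1 * (γ t).2| ≤ C := by
    intro t ht
    rw [abs_mul]
    refine mul_le_mul ?_ (hy' t ht) (abs_nonneg _) ?_
    · have h1 : (γ t).1 ^ 2 ≤ N ^ 2 := by
        rw [← sq_abs]
        exact pow_le_pow_left₀ (abs_nonneg _) (hx t ht) 2
      have h2 := H.le_neg_one
      unfold damping
      rw [abs_mul, abs_of_pos H.pos]
      refine mul_le_mul_of_nonneg_left (abs_le.2 ⟨?_, ?_⟩) H.pos.le <;>
        nlinarith [sq_nonneg (γ t).1]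
    · exact mul_nonneg H.pos.le (by nlinarith [H.le_neg_one])
  have hC0 : 0 ≤ C := (abs_nonneg _).trans (hCf 0 le_rfl)
  have hder : ∀ t, 0 ≤ t → HasDerivAt
      (fun t => (γ t).2 ^ 2 / 2 + potential a1 (γ t).1 - C * (γ t).1)
      (-damping a2 δ (γ t).1 * (γ t).2 ^ 2 - C * (γ t).2) t := fun t ht =>
    (hasDerivAt_energy_of_field (hγ t ht)).sub ((hasDerivAt_fst (hγ t ht)).const_mul C)
  have hQm : MonotoneOn (fun t => (γ t).2 ^ 2 / 2 + potential a1 (γ t).1 - C * (γ t).1)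
      (Ici 0) := by
    refine monotoneOn_of_deriv_nonneg (convex_Ici 0)
      (fun t ht => (hder t ht).continuousAt.continuousWithinAt) ?_ ?_
    · intro t ht
      rw [interior_Ici] at ht
      exact (hder t ht.le).differentiableAt.differentiableWithinAt
    · intro t ht
      rw [interior_Ici] at ht
      rw [(hder t ht.le).deriv]
      have h1 := (abs_le.1 (hCf t ht.le)).1
      have h2 := hy t ht
      nlinarith
  obtain ⟨q, hq, -⟩ := exists_tendsto_of_monotoneOn
    (C := N ^ 2 / 2 + (N ^ 6 + N ^ 2) / 2 + C * N) hQm (by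
      intro t ht
      have h1 := two_mul_potential_le H (hx t ht)
      have h2 : (γ t).2 ^ 2 ≤ N ^ 2 := by
        rw [← sq_abs]
        exact pow_le_pow_left₀ (abs_nonneg _) (hy' t ht) 2
      have h3 := (abs_le.1 (hx t ht)).1
      nlinarith)
  have hy2 : Tendsto (fun t => (γ t).2 ^ 2) atTop
      (𝓝 (2 * (q + C * -l' - potential a1 (-l')))) := by
    have hG := (continuous_potential a1).continuousAt.tendsto.comp hl
    refine (((hq.add (hl.const_mul C)).sub hG).const_mul 2).congr fun t => ?_
    simp only [Function.comp]
    ring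
  have hyl : Tendsto (fun t => (γ t).2) atTop
      (𝓝 (-√(2 * (q + C * -l' - potential a1 (-l'))))) := by
    refine hy2.sqrt.neg.congr' ?_
    filter_upwards [eventually_gt_atTop 0] with t ht
    rw [Real.sqrt_sq_eq_abs, abs_of_neg (hy t ht), neg_neg]
  set m := -√(2 * (q + C * -l' - potential a1 (-l'))) with hm
  have hγl : Tendsto γ atTop (𝓝 (-l', m)) := hl.prodMk_nhds hyl
  have hv := (continuous_truncField a1 a2 δ hN0.le).continuousAt.tendsto.comp hγl
  have hz : ‖((-l', m) : ℝ × ℝ)‖ ≤ N := le_of_tendsto hγl.norm (by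
    filter_upwards [eventually_ge_atTop 0] with t ht using (hbox t ht).le)
  rw [truncField_of_norm_le hz] at hv
  have e1 := eq_zero_of_tendsto_deriv (fun t => hasDerivAt_fst (S.deriv t)) hl
    ((continuous_fst.tendsto _).comp hv)
  have e2 := eq_zero_of_tendsto_deriv (fun t => hasDerivAt_snd (S.deriv t)) hyl
    ((continuous_snd.tendsto _).comp hv)
  simp only [field] at e1 e2
  rw [e1] at hyl e2
  exact ⟨-l', hl, hyl, by linarith, hgt⟩

lemma exists_nonneg (S : Shot a1 a2 δ B b γ) (H : Admissible a1 a2 δ) :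
    ∃ t, 0 < t ∧ 0 ≤ (γ t).2 := by
  by_contra! hy
  obtain ⟨l, hl, hyl, hf, hgt⟩ := S.exists_limit H hy
  have hγ : ∀ t, 0 ≤ t → HasDerivAt γ (field a1 a2 δ (γ t)) t := fun t ht =>
    S.hasDerivAt H (T := t) (fun r hr => hy r hr.1) t ⟨ht, le_rfl⟩
  have hs0 := H.sqrt_pos
  have hs1 := H.sqrt_lt_one
  have hc1 := H.one_le_sqrt
  have hb1 := S.one_lt H
  have harc : ∀ T, 0 < T → ∃ w, IsArc a1 a2 δ w (γ T).1 b ∧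
      (∀ t ∈ Icc 0 T, w (γ t).1 = -(γ t).2) ∧
      ∀ x ∈ Icc (γ T).1 b, ∃ t ∈ Icc 0 T, (γ t).1 = x := by
    intro T hT
    have := exists_isArc hT (fun t ht => hγ t ht.1) (fun t ht => hy t ht.1)
    rwa [S.init] at this
  rcases eq_of_force_eq_zero H hf with rfl | rfl | ⟨h1, h2⟩
  · have ev := (hyl.eventually (lt_mem_nhds (show -((1 + a1) / δ) < 0 by
      have := H.pos
      have := H.neg_one_lt
      rw [neg_lt_zero]
      exact div_pos (by linarith) H.pos))).and (eventually_gt_atTop 0)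
    obtain ⟨T, hT⟩ := eventually_atTop.1 ev
    have hT0 := (hT T le_rfl).2
    have hneg : ∀ t, T ≤ t → -force a1 (γ t).1 - damping a2 δ (γ t).1 * (γ t).2 ≤ 0 := by
      intro t ht
      obtain ⟨h1, h2⟩ := hT t ht
      have h3 := hgt t h2.le
      have h4 := hy t h2
      have h5 : -(1 + a1) < δ * (γ t).2 := by
        rw [neg_lt, lt_div_iff₀ H.pos] at h1
        linarith
      have h6 : damping a2 δ (γ t).1 ≤ δ * ((γ t).1 ^ 2 - 1) := by
        unfold damping
        nlinarith [H.pos, H.le_neg_one]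
      have h7 : 0 ≤ (γ t).1 ^ 2 - 1 := by nlinarith
      have h8 : 1 + a1 ≤ (γ t).1 * (a1 + (γ t).1 ^ 2) := by nlinarith [H.neg_one_lt]
      unfold force
      nlinarith [mul_nonneg h7 (show 0 ≤ (γ t).1 * (a1 + (γ t).1 ^ 2) + δ * (γ t).2 by linarith)]
    have hanti : AntitoneOn (fun t => (γ t).2) (Ici T) := by
      refine antitoneOn_of_deriv_nonpos (convex_Ici T)
        (fun t ht => (hasDerivAt_snd (hγ t (hT0.le.trans ht))).continuousAt.continuousWithinAt) ?_ ?_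
      · intro t ht
        rw [interior_Ici] at ht
        exact (hasDerivAt_snd (hγ t (hT0.trans ht).le)).differentiableAt.differentiableWithinAt
      · intro t ht
        rw [interior_Ici] at ht
        rw [(hasDerivAt_snd (hγ t (hT0.trans ht).le)).deriv]
        exact hneg t ht.le
    have := le_of_tendsto hyl (b := (γ T).2) (by
      filter_upwards [eventually_ge_atTop T] with t ht
      exact hanti (le_refl T) ht ht)
    linarith [hy T hT0]
  · set D := fun θ => dampingPrim a2 δ (fold a1 (-θ)) - dampingPrim a2 δ (fold a1 θ) with hD
    have hD0 : 0 < D (π / 3) := by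
      have := dampingPrim_fold_lt H.neg_one_lt H.neg H.pos H.le_neg_one
        (show 0 < π / 3 by positivity) le_rfl
      simp only [hD]
      linarith
    have hDc : Continuous D := by
      have hF : Continuous (dampingPrim a2 δ) := by unfold dampingPrim; fun_prop
      exact (hF.comp ((continuous_fold a1).comp continuous_neg)).sub
        (hF.comp (continuous_fold a1))
    obtain ⟨η, hη, hηD⟩ := Metric.eventually_nhds_iff.1
      (hDc.continuousAt.eventually (lt_mem_nhds (half_lt_self hD0)))
    have hmono := fold_strictMonoOn H.neg_one_lt H.neg
    set θ₀ := max 0 (π / 3 - η) with hθ₀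
    have hpi : 0 < π / 3 := by positivity
    have h00 : 0 ≤ θ₀ := le_max_left _ _
    have h01 : θ₀ < π / 3 := max_lt hpi (by linarith)
    have hlt : √(-a1) < fold a1 (-θ₀) := by
      rw [← fold_neg_pi_div_three]
      exact hmono ⟨le_rfl, by linarith⟩ ⟨by linarith, by linarith⟩ (by linarith)
    have ev := ((hl.eventually (gt_mem_nhds hlt)).and (hl.eventually (gt_mem_nhds hs1))).and
      ((eventually_gt_atTop 0).and (hyl.eventually (lt_mem_nhds
        (show -(D (π / 3) / 2) < 0 by linarith))))
    obtain ⟨T, ⟨hT1, hT2⟩, hT3, hT4⟩ := ev.exists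
    obtain ⟨w, A, hw, -⟩ := harc T hT3
    obtain ⟨θ, hθ0, hθ1, hθ⟩ := exists_fold_eq_of_lt_one (hgt T hT3.le).le hT2
    have hθθ : θ₀ < θ := by
      by_contra! hcon
      have := hmono.monotoneOn (a := -θ₀) (b := -θ) ⟨by linarith, by linarith⟩
        ⟨by linarith, by linarith⟩ (by linarith)
      linarith
    have hDθ : D (π / 3) / 2 < D θ := hηD (by
      rw [Real.dist_eq, abs_of_nonpos (by linarith)]
      linarith [le_max_right 0 (π / 3 - η)])
    have hle : fold a1 θ ≤ b := (hmono.monotoneOn ⟨by linarith, hθ1⟩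
      ⟨by linarith, le_rfl⟩ hθ1).trans S.fold_le
    have hlt' : fold a1 (-θ) < fold a1 θ :=
      hmono ⟨by linarith, by linarith⟩ ⟨by linarith, hθ1⟩ (by linarith)
    have h4 := A.fold_le H hθ0 hθ1 hθ.ge hle
    have h5 := A.nonneg (fold a1 θ) ⟨by linarith, hle⟩
    have h6 := hw T ⟨hT3.le, le_rfl⟩
    rw [hθ] at h4
    simp only [hD, hθ] at hDθ
    linarith
  · obtain ⟨T₀, hT₀, hT₀'⟩ := ((hl.eventually (gt_mem_nhds h2)).and (eventually_gt_atTop 0)).exists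
    obtain ⟨w₀, A₀, -, hsurj⟩ := harc T₀ hT₀'
    obtain ⟨r, hr, hrs⟩ := hsurj √(-a1) ⟨hT₀.le, by linarith⟩
    have hr0 : 0 < r := by
      refine hr.1.lt_of_ne ?_
      rintro rfl
      rw [S.init] at hrs
      linarith
    have hE : ∀ T, T₀ ≤ T → (γ r).2 ^ 2 / 2 + potential a1 √(-a1) ≤
        (γ T).2 ^ 2 / 2 + potential a1 (γ T).1 := by
      intro T hT
      have hT' := hT₀'.trans_le hT
      obtain ⟨w, A, hw, -⟩ := harc T hT'
      have hlow := (abs_le.1 h1).1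
      have hgtT := hgt T hT'.le
      have hx : (γ T).1 ≤ √(-a1) := by
        rw [← hrs]
        exact (strictAntiOn_fst (fun q hq => hγ q hq.1) (fun q hq => hy q hq.1) (t₁ := T)).antitoneOn
          ⟨hr.1, hr.2.trans hT⟩ ⟨hT'.le, le_rfl⟩ (hr.2.trans hT)
      have := ((A.mono (p' := (γ T).1) (b' := √(-a2)) (by linarith) le_rfl
        S.sqrt_le).strictAntiOn_energy H (by linarith) le_rfl).antitoneOn
        (a := (γ T).1) (b := √(-a1)) ⟨le_rfl, by linarith⟩ ⟨hx, by linarith⟩ hx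
      rw [hw T ⟨hT'.le, le_rfl⟩, ← hrs, hw r ⟨hr.1, hr.2.trans hT⟩, neg_sq, neg_sq, hrs] at this
      exact this
    have hlim := ((hyl.pow 2).div_const 2).add
      ((continuous_potential a1).continuousAt.tendsto.comp hl)
    have := ge_of_tendsto hlim (b := (γ r).2 ^ 2 / 2 + potential a1 √(-a1)) (by
      filter_upwards [eventually_ge_atTop T₀] with T hT using hE T hT)
    have h3 := potential_le_potential_sqrt H h1
    have h4 := hy r hr0
    norm_num at this
    nlinarith

/-- A shot returns to the axis. -/
lemma exists_land (S : Shot a1 a2 δ B b γ) (H : Admissible a1 a2 δ) :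
    ∃ t₁, 0 < t₁ ∧ (γ t₁).2 = 0 ∧ ∀ t ∈ Ioo 0 t₁, (γ t).2 < 0 := by
  obtain ⟨T, hT, hyT⟩ := S.exists_nonneg H
  have hd := hasDerivAt_snd (S.deriv 0)
  have hn : ‖γ 0‖ ≤ boxBound a2 δ B := by
    rw [S.init, Prod.norm_mk, norm_zero, Real.norm_eq_abs, abs_of_pos (by linarith [S.one_lt H])]
    exact max_le (S.le.trans (lt_boxBound H (S.sqrt_le.trans S.le)).le) (S.boxBound_pos H).le
  rw [truncField_of_norm_le hn, S.init] at hd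
  obtain ⟨t₁, h1, -, h2, h3⟩ := exists_first_zero (continuous_snd.comp S.continuous) hd
    (by simp [S.init]) (by
      have := force_pos_of_one_lt H.neg_one_lt (S.one_lt H)
      simp [field, this]) hT hyT
  exact ⟨t₁, h1, h2, h3⟩

end Shot

lemma fold_pi_div_three_lt_two (H : Admissible a1 a2 δ) : fold a1 (π / 3) < 2 := by
  have h1 := fold_sq H.neg_one_lt H.neg (θ := π / 3) (by linarith [pi_pos]) le_rfl
  rw [sub_self, cos_zero] at h1
  nlinarith [H.neg]

/-- Orbits depend continuously on the initial point, uniformly on compact time intervals. -/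
lemma eventually_dist_lt {K : NNReal} {v : ℝ × ℝ → ℝ × ℝ} (hv : LipschitzWith K v)
    {Φ : ℝ → ℝ → ℝ × ℝ} (h0 : ∀ b, Φ b 0 = (b, 0))
    (hΦ : ∀ b t, HasDerivAt (Φ b) (v (Φ b t)) t) (b t : ℝ) {ε : ℝ} (hε : 0 < ε) :
    ∀ᶠ b' in 𝓝 b, ∀ r ∈ Icc 0 t, dist (Φ b' r) (Φ b r) < ε := by
  have hpos : 0 < ε / Real.exp (K * t) := by positivity
  filter_upwards [Metric.ball_mem_nhds b hpos] with b' hb' r hr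
  have h1 := dist_le_of_hasDerivAt hv (hΦ b') (hΦ b) hr.1
  have h2 : dist (Φ b' 0) (Φ b 0) = dist b' b := by
    rw [h0, h0, Prod.dist_eq]
    simp
  rw [h2] at h1
  have h3 : Real.exp (K * r) ≤ Real.exp (K * t) :=
    Real.exp_le_exp.2 (mul_le_mul_of_nonneg_left hr.2 K.2)
  calc dist (Φ b' r) (Φ b r) ≤ dist b' b * Real.exp (K * r) := h1
    _ ≤ dist b' b * Real.exp (K * t) := mul_le_mul_of_nonneg_left h3 dist_nonneg
    _ < ε := (lt_div_iff₀ (Real.exp_pos _)).1 hb'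

/-- The initial points whose orbits reach `x < -b` before landing. -/
def overshoot (Φ : ℝ → ℝ → ℝ × ℝ) : Set ℝ :=
  {b | ∃ t, 0 ≤ t ∧ (Φ b t).1 < -b ∧ ∀ r ∈ Icc 0 t, 0 < (Φ b r).1 ∨ (Φ b r).2 < 0}

/-- The initial points whose orbits reach the upper half plane before `x = -b`. -/
def undershoot (Φ : ℝ → ℝ → ℝ × ℝ) : Set ℝ :=
  {b | ∃ t, 0 ≤ t ∧ 0 < (Φ b t).2 ∧ ∀ r ∈ Icc 0 t, -b < (Φ b r).1}

section Open

variable {K : NNReal} {v : ℝ × ℝ → ℝ × ℝ} {Φ : ℝ → ℝ → ℝ × ℝ}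

lemma isOpen_overshoot (hv : LipschitzWith K v) (h0 : ∀ b, Φ b 0 = (b, 0))
    (hΦ : ∀ b t, HasDerivAt (Φ b) (v (Φ b t)) t) : IsOpen (overshoot Φ) := by
  rw [isOpen_iff_mem_nhds]
  rintro b ⟨t, ht, hx, hr⟩
  have hU : IsOpen {z : ℝ × ℝ | 0 < z.1 ∨ z.2 < 0} :=
    (isOpen_lt continuous_const continuous_fst).union (isOpen_lt continuous_snd continuous_const)
  obtain ⟨ε, hε, hsub⟩ := (isCompact_Icc.image (continuous_of_hasDerivAt (hΦ b))
    (s := Icc 0 t)).exists_thickening_subset_open hU (by rintro _ ⟨r, hr', rfl⟩; exact hr r hr')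
  have hε' : 0 < min ε ((-b - (Φ b t).1) / 2) := lt_min hε (by linarith)
  filter_upwards [eventually_dist_lt hv h0 hΦ b t hε', Metric.ball_mem_nhds b hε'] with b' h1 h2
  refine ⟨t, ht, ?_, fun r hr' => hsub (Metric.mem_thickening_iff.2 ⟨Φ b r, ⟨r, hr', rfl⟩,
    (h1 r hr').trans_le (min_le_left _ _)⟩)⟩
  have h3 := (h1 t ⟨ht, le_rfl⟩).trans_le (min_le_right _ _)
  have h4 := (Metric.mem_ball.1 h2).trans_le (min_le_right _ _)
  have h5 : dist (Φ b' t).1 (Φ b t).1 ≤ dist (Φ b' t) (Φ b t) := le_max_left _ _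
  rw [Real.dist_eq] at h4 h5
  have h6 := (abs_lt.1 (h5.trans_lt h3)).2
  have h7 := (abs_lt.1 h4).2
  linarith

lemma isOpen_undershoot (hv : LipschitzWith K v) (h0 : ∀ b, Φ b 0 = (b, 0))
    (hΦ : ∀ b t, HasDerivAt (Φ b) (v (Φ b t)) t) : IsOpen (undershoot Φ) := by
  rw [isOpen_iff_mem_nhds]
  rintro b ⟨t, ht, hy, hr⟩
  obtain ⟨r₀, hr₀, hmin⟩ := (isCompact_Icc (a := (0 : ℝ)) (b := t)).exists_isMinOn ⟨0, le_rfl, ht⟩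
    (continuous_fst.comp (continuous_of_hasDerivAt (hΦ b))).continuousOn
  have hm := hr r₀ hr₀
  have hε' : 0 < min (Φ b t).2 (((Φ b r₀).1 + b) / 2) := lt_min hy (by linarith)
  filter_upwards [eventually_dist_lt hv h0 hΦ b t hε', Metric.ball_mem_nhds b hε'] with b' h1 h2
  have h4 := (Metric.mem_ball.1 h2).trans_le (min_le_right _ _)
  rw [Real.dist_eq] at h4
  refine ⟨t, ht, ?_, fun r hr' => ?_⟩
  · have h3 := (h1 t ⟨ht, le_rfl⟩).trans_le (min_le_left _ _)
    have h5 : dist (Φ b' t).2 (Φ b t).2 ≤ dist (Φ b' t) (Φ b t) := le_max_right _ _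
    rw [Real.dist_eq] at h5
    have h6 := (abs_lt.1 (h5.trans_lt h3)).1
    linarith
  · have h3 := (h1 r hr').trans_le (min_le_right _ _)
    have h5 : dist (Φ b' r).1 (Φ b r).1 ≤ dist (Φ b' r) (Φ b r) := le_max_left _ _
    rw [Real.dist_eq] at h5
    have h6 := (abs_lt.1 (h5.trans_lt h3)).1
    have h7 := (abs_lt.1 h4).1
    have h8 : (Φ b r₀).1 ≤ (Φ b r).1 := hmin hr'
    linarith

end Open

namespace Shot

variable {B b : ℝ} {γ : ℝ → ℝ × ℝ} {Φ : ℝ → ℝ → ℝ × ℝ}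

lemma fst_mem (S : Shot a1 a2 δ B b γ) (H : Admissible a1 a2 δ) {t₁ : ℝ}
    (hy : ∀ t ∈ Ioo 0 t₁, (γ t).2 < 0) : StrictAntiOn (fun t => (γ t).1) (Icc 0 t₁) :=
  strictAntiOn_fst (S.hasDerivAt H hy) hy

lemma mem_overshoot (S : Shot a1 a2 δ B b (Φ b)) (H : Admissible a1 a2 δ) {t₁ : ℝ} (h1 : 0 < t₁)
    (hy : ∀ t ∈ Ioo 0 t₁, (Φ b t).2 < 0) (hlt : (Φ b t₁).1 < -b) : b ∈ overshoot Φ := by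
  have ev : ∀ᶠ t in 𝓝[<] t₁, (Φ b t).1 < -b :=
    ((continuous_fst.comp S.continuous).continuousAt.eventually
      (gt_mem_nhds hlt)).filter_mono nhdsWithin_le_nhds
  obtain ⟨t, ht, ht0⟩ := (ev.and (Ioo_mem_nhdsLT h1)).exists
  refine ⟨t, ht0.1.le, ht, fun r hr => ?_⟩
  rcases hr.1.eq_or_lt with rfl | h
  · left
    rw [S.init]
    exact zero_lt_one.trans (S.one_lt H)
  · exact Or.inr (hy r ⟨h, hr.2.trans_lt ht0.2⟩)

lemma mem_undershoot (S : Shot a1 a2 δ B b (Φ b)) (H : Admissible a1 a2 δ) {t₁ : ℝ} (h1 : 0 < t₁)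
    (hy : ∀ t ∈ Ioo 0 t₁, (Φ b t).2 < 0) (hy1 : (Φ b t₁).2 = 0) (hlt : -b < (Φ b t₁).1) :
    b ∈ undershoot Φ := by
  have hland := S.land_lt H h1 hy hy1
  have hc := H.one_le_sqrt
  have hd := hasDerivAt_snd (S.hasDerivAt H hy t₁ ⟨h1.le, le_rfl⟩)
  have hpos : 0 < (field a1 a2 δ (Φ b t₁)).2 := by
    have := force_pos_of_one_lt H.neg_one_lt (x := -(Φ b t₁).1) (by linarith)
    rw [force_neg] at this
    simpa [field, hy1] using this
  obtain ⟨ε, hε, hup⟩ := eventually_neg_of_hasDerivAt hd.neg (by simp [hy1]) (neg_neg_of_pos hpos)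
  have ev : ∀ᶠ t in 𝓝 t₁, -b < (Φ b t).1 :=
    (continuous_fst.comp S.continuous).continuousAt.eventually (lt_mem_nhds hlt)
  obtain ⟨η, hη, hηx⟩ := Metric.eventually_nhds_iff.1 ev
  set m := min ε η / 2 with hm
  have hm0 : 0 < min ε η := lt_min hε hη
  refine ⟨t₁ + m, by linarith, ?_, fun r hr => ?_⟩
  · have := (hup m ⟨by linarith, by linarith [min_le_left ε η]⟩).1
    exact neg_lt_zero.1 this
  · rcases le_total r t₁ with h | h
    · exact hlt.trans_le ((S.fst_mem H hy).antitoneOn ⟨hr.1, h⟩ ⟨h1.le, le_rfl⟩ h)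
    · refine hηx ?_
      rw [Real.dist_eq, abs_of_nonneg (by linarith)]
      linarith [min_le_right ε η, hr.2]

lemma not_mem_both (S : Shot a1 a2 δ B b (Φ b)) (H : Admissible a1 a2 δ) :
    b ∉ overshoot Φ ∩ undershoot Φ := by
  rintro ⟨⟨t, ht, hx, hr⟩, ⟨t', ht', hy, hr'⟩⟩
  obtain ⟨t₁, h1, h2, h3⟩ := S.exists_land H
  have hland := S.land_lt H h1 h3 h2
  have hc := H.one_le_sqrt
  have hlt : t' < t := by
    by_contra! hcon
    linarith [hr' t ⟨ht, hcon⟩]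
  have hle : t₁ ≤ t' := by
    by_contra! hcon
    have h4 : t' ≠ 0 := by
      rintro rfl
      rw [S.init] at hy
      exact lt_irrefl _ hy
    linarith [h3 t' ⟨ht'.lt_of_ne h4.symm, hcon⟩]
  rcases hr t₁ ⟨h1.le, hle.trans hlt.le⟩ with h | h <;> linarith

/-- A shot landing at the opposite point closes up to a periodic orbit. -/
lemma isNonconstPeriodicSolII (S : Shot a1 a2 δ B b γ) (H : Admissible a1 a2 δ) {t₁ : ℝ}
    (h1 : 0 < t₁) (hy : ∀ t ∈ Ioo 0 t₁, (γ t).2 < 0) (h : γ t₁ = -γ 0) :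
    IsNonconstPeriodicSolII a1 a2 δ γ := by
  have hN := S.boxBound_pos H
  obtain ⟨K, hK⟩ := exists_lipschitzWith_truncField a1 a2 δ hN.le
  have hhalf : (fun t => γ (t + t₁)) = fun t => -γ t := by
    refine eq_of_hasDerivAt hK (fun t => (S.deriv (t + t₁)).comp_add_const t t₁) (fun t => ?_)
      (by simpa using h)
    rw [truncField_neg hN.le]
    exact (S.deriv t).neg
  have hhalf' : ∀ t, γ (t + t₁) = -γ t := congrFun hhalf
  have hper : Function.Periodic (fun t => ‖γ t‖) t₁ := fun t => by
    simp only [hhalf', norm_neg]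
  have hbox : ∀ t, ‖γ t‖ ≤ boxBound a2 δ B := by
    intro t
    obtain ⟨r, hr, hrt⟩ := hper.exists_mem_Ico₀ h1 t
    rw [hrt]
    exact (S.norm_lt H hy r (Ico_subset_Icc_self hr)).le
  refine ⟨isSolII_iff.2 fun t => ?_, ⟨t₁ + t₁, by linarith, fun t => ?_⟩, fun hcon => ?_⟩
  · rw [← truncField_of_norm_le (hbox t)]
    exact S.deriv t
  · rw [← add_assoc, hhalf', hhalf', neg_neg]
  · have h2 := hcon t₁ 0
    rw [h, S.init] at h2
    have h3 := congrArg Prod.fst h2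
    simp only [Prod.fst_neg] at h3
    linarith [S.one_lt H]

end Shot

theorem exists_isNonconstPeriodicSolII (H : Admissible a1 a2 δ) :
    ∃ γ, IsNonconstPeriodicSolII a1 a2 δ γ := by
  set B := farBound a2 δ with hB
  have hcB := two_mul_sqrt_lt_farBound H
  have hc := H.one_le_sqrt
  have hs2 := fold_pi_div_three_lt_two H
  set b₀ := max √(-a2) (fold a1 (π / 3)) with hb₀
  have hb₀B : b₀ ≤ B := max_le (by linarith) (by linarith)
  have hN := boxBound_pos H (B := B) (by linarith)
  choose Φ h0 hΦ using fun b : ℝ => exists_solution_truncField a1 a2 δ hN.le (b, 0)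
  obtain ⟨K, hK⟩ := exists_lipschitzWith_truncField a1 a2 δ hN.le
  have hS : ∀ b ∈ Icc b₀ B, Shot a1 a2 δ B b (Φ b) := fun b hb =>
    ⟨(le_max_left _ _).trans hb.1, hb.2, (le_max_right _ _).trans hb.1, h0 b, hΦ b⟩
  by_contra! hno
  have hne : ∀ b ∈ Icc b₀ B, ∀ t₁, 0 < t₁ → (Φ b t₁).2 = 0 → (∀ t ∈ Ioo 0 t₁, (Φ b t).2 < 0) →
      (Φ b t₁).1 ≠ -b := by
    intro b hb t₁ h1 h2 h3 h4
    refine hno _ ((hS b hb).isNonconstPeriodicSolII H h1 h3 ?_)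
    rw [(hS b hb).init]
    exact Prod.ext h4 (by simpa using h2)
  have hcover : Icc b₀ B ⊆ overshoot Φ ∪ undershoot Φ := by
    intro b hb
    obtain ⟨t₁, h1, h2, h3⟩ := (hS b hb).exists_land H
    rcases (hne b hb t₁ h1 h2 h3).lt_or_gt with h | h
    · exact Or.inl ((hS b hb).mem_overshoot H h1 h3 h)
    · exact Or.inr ((hS b hb).mem_undershoot H h1 h3 h2 h)
  have hmem₀ : b₀ ∈ Icc b₀ B := ⟨le_rfl, hb₀B⟩
  have hmemB : B ∈ Icc b₀ B := ⟨hb₀B, le_rfl⟩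
  have hleft : b₀ ∈ overshoot Φ := by
    have S := hS b₀ hmem₀
    obtain ⟨t₁, h1, h2, h3⟩ := S.exists_land H
    have hland := S.land_lt H h1 h3 h2
    refine S.mem_overshoot H h1 h3 ?_
    rcases le_total (fold a1 (π / 3)) √(-a2) with h | h
    · have e : b₀ = √(-a2) := max_eq_left h
      linarith
    · by_contra! hcon
      have e : b₀ = fold a1 (π / 3) := max_eq_right h
      obtain ⟨w, A, hw, -⟩ := exists_isArc h1 (S.hasDerivAt H h3) h3
      have hw1 := hw t₁ ⟨h1.le, le_rfl⟩
      rw [h2, neg_zero] at hw1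
      rw [S.init] at A
      obtain ⟨θ, hθ0, hθ1, hθ⟩ := exists_fold_eq_of_one_lt (x := -(Φ b₀ t₁).1) (a1 := a1)
        (by linarith) (by linarith)
      have hθ' : (Φ b₀ t₁).1 = -fold a1 θ := by rw [hθ, neg_neg]
      have hpos := fold_pos H.neg_one_lt H.neg (θ := -θ) (by linarith) (by linarith)
      have hlt : fold a1 (-θ) < fold a1 θ := fold_strictMonoOn H.neg_one_lt H.neg
        ⟨by linarith, by linarith⟩ ⟨by linarith, hθ1⟩ (by linarith)
      have hb1 := S.one_lt H
      have h4 := A.fold_neg_lt H hθ0 hθ1 hθ'.le (by simp only; linarith)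
      rw [← hθ', hw1] at h4
      linarith [A.nonneg (-fold a1 (-θ)) ⟨by rw [hθ']; linarith, by simp only; linarith⟩]
  have hright : B ∈ undershoot Φ := by
    have S := hS B hmemB
    obtain ⟨t₁, h1, h2, h3⟩ := S.exists_land H
    refine S.mem_undershoot H h1 h3 h2 ((hne B hmemB t₁ h1 h2 h3).symm.lt_of_le ?_)
    obtain ⟨w, A, hw, -⟩ := exists_isArc h1 (S.hasDerivAt H h3) h3
    have hw0 := hw 0 ⟨le_rfl, h1.le⟩
    have hw1 := hw t₁ ⟨h1.le, le_rfl⟩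
    rw [h2, neg_zero] at hw1
    rw [S.init] at A hw0
    exact A.neg_le_of_farBound H (by simpa using hw0) hw1
  obtain ⟨b, hb, hb'⟩ := isPreconnected_Icc (a := b₀) (b := B) _ _ (isOpen_overshoot hK h0 hΦ)
    (isOpen_undershoot hK h0 hΦ) hcover ⟨b₀, hmem₀, hleft⟩ ⟨B, hmemB, hright⟩
  exact (hS b hb).not_mem_both H hb'

end SystemII

/-- for −1 < a1 < 0, δ > 0 and a2 ≤ −1, system (II) has a nonconstant
periodic solution, and any two nonconstant periodic solutions have the same image
(a unique limit cycle). -/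
theorem stmt18 (a1 a2 δ : ℝ) (ha1l : -1 < a1) (ha1r : a1 < 0) (hδ : 0 < δ)
    (ha2 : a2 ≤ -1) :
    (∃ γ : ℝ → ℝ × ℝ, IsNonconstPeriodicSolII a1 a2 δ γ) ∧
    (∀ γ1 γ2 : ℝ → ℝ × ℝ, IsNonconstPeriodicSolII a1 a2 δ γ1 →
      IsNonconstPeriodicSolII a1 a2 δ γ2 → Set.range γ1 = Set.range γ2) := by
  have H : SystemII.Admissible a1 a2 δ := ⟨ha1l, ha1r, hδ, ha2⟩
  exact ⟨SystemII.exists_isNonconstPeriodicSolII H, fun _ _ h₁ h₂ => SystemII.range_eq_range H h₁ h₂⟩
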